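/- arXiv:math/0001022 — 2 statements merged into one kernel-verified Lean document; each statement's English description precedes it below -/
import Mathlib

section
/- Fix a real number t with 0 < t < 1, a real number β > 0 with βt < 1, and positive integers N and l. Then φ(N, 2l+1, t, β) = (1-t²)^{N(N-1)/2} · det(H_l), where H_l = (h_{jk})_{0≤j,k<l} is the l×l Hankel matrix with entries h_{jk} = (2^{j+k+1}/π) ∫_{-1}^{1} x^{j+k} (1+t²-2tx)^{-N} (1-x²)^{1/2} dx (for l = 0 the determinant of the empty matrix is 1, and the right-hand side is then (1-t²)^{N(N-1)/2}). -/
open scoped Classical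

noncomputable section

/-- Semistandard Young tableaux of shape `μ` with entries in `{1, …, N}`. -/
def SSYTN (N : ℕ) (μ : YoungDiagram) : Type :=
  {T : SemistandardYoungTableau μ // ∀ i j : ℕ, (i, j) ∈ μ → T i j ∈ Finset.Icc 1 N}

/-- `d_λ(N)`: the number of semistandard Young tableaux of shape `μ`
with entries in `{1, …, N}`. -/
def dCount (N : ℕ) (μ : YoungDiagram) : ℕ := Nat.card (SSYTN N μ)

/-- `f(λ')`: the number of odd columns of `μ`. -/
def oddCols (μ : YoungDiagram) : ℕ :=
  ((Finset.range μ.card).filter fun j => Odd (μ.colLen j)).card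

/-- `ℓ(λ)`: the number of rows of `μ` (the length of its first column). -/
def numRows (μ : YoungDiagram) : ℕ := μ.colLen 0

/-- The generating function
`φ(N, l, t, β) = (1-t²)^{N(N-1)/2} (1-βt)^N Σ_{ℓ(λ) ≤ l} t^{|λ|} β^{f(λ')} d_λ(N)`. -/
def phiGF (N l : ℕ) (t β : ℝ) : ℝ :=
  (1 - t ^ 2) ^ (N * (N - 1) / 2) * (1 - β * t) ^ N *
    ∑' μ : {μ : YoungDiagram // numRows μ ≤ l},
      t ^ (μ.1.card) * β ^ (oddCols μ.1) * (dCount N μ.1 : ℝ)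

/-- Extension by zero of a finite sequence of row lengths. -/
def extZero {n : ℕ} (f : Fin n → ℕ) (i : ℕ) : ℕ := if h : i < n then f ⟨i, h⟩ else 0

theorem extZero_of_lt {n : ℕ} (f : Fin n → ℕ) {i : ℕ} (h : i < n) : extZero f i = f ⟨i, h⟩ :=
  dif_pos h

@[simp]
theorem extZero_val {n : ℕ} (f : Fin n → ℕ) (i : Fin n) : extZero f i = f i :=
  dif_pos i.2

theorem extZero_of_le {n : ℕ} (f : Fin n → ℕ) {i : ℕ} (h : n ≤ i) : extZero f i = 0 :=
  dif_neg (by omega)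

theorem extZero_antitone {n : ℕ} {f : Fin n → ℕ} (hf : Antitone f) : Antitone (extZero f) := by
  intro i j hij
  by_cases hj : j < n
  · rw [extZero_of_lt f hj, extZero_of_lt f (lt_of_le_of_lt hij hj)]
    exact hf hij
  · rw [extZero_of_le f (not_lt.1 hj)]
    exact Nat.zero_le _

/-- The Young diagram with row lengths `f` (for antitone `f`). -/
def diagOf {n : ℕ} (f : Fin n → ℕ) : YoungDiagram where
  cells := (Finset.range n ×ˢ Finset.range (∑ i, f i)).filter
    fun c => ∀ i ≤ c.1, c.2 < extZero f i
  isLowerSet := by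
    rintro ⟨a, b⟩ ⟨c, d⟩ hle h
    have h1 : c ≤ a := hle.1
    have h2 : d ≤ b := hle.2
    simp only [Finset.coe_filter, Finset.mem_product, Finset.mem_range, Set.mem_ofPred_eq] at h ⊢
    exact ⟨⟨by omega, by omega⟩, fun i hi => lt_of_le_of_lt h2 (h.2 i (hi.trans h1))⟩

theorem mem_diagOf {n : ℕ} {f : Fin n → ℕ} (hf : Antitone f) {i j : ℕ} :
    (i, j) ∈ diagOf f ↔ j < extZero f i := by
  rw [← YoungDiagram.mem_cells]
  simp only [diagOf, Finset.mem_filter, Finset.mem_product, Finset.mem_range]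
  constructor
  · intro h
    exact h.2 i le_rfl
  · intro h
    have hi : i < n := by
      by_contra hi
      rw [extZero_of_le f (not_lt.1 hi)] at h
      omega
    refine ⟨⟨hi, ?_⟩, fun k hk => lt_of_lt_of_le h (extZero_antitone hf hk)⟩
    rw [extZero_of_lt f hi] at h
    exact lt_of_lt_of_le h (Finset.single_le_sum (fun _ _ => Nat.zero_le _) (Finset.mem_univ _))

theorem rowLen_diagOf {n : ℕ} {f : Fin n → ℕ} (hf : Antitone f) (i : ℕ) :
    (diagOf f).rowLen i = extZero f i := by
  apply eq_of_forall_lt_iff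
  intro j
  rw [← YoungDiagram.mem_iff_lt_rowLen, mem_diagOf hf]

theorem rowLen_antitone (μ : YoungDiagram) (n : ℕ) :
    Antitone fun i : Fin n => μ.rowLen i := fun _ _ h => μ.rowLen_anti _ _ h

theorem rowLen_eq_zero_of_numRows_le {μ : YoungDiagram} {n i : ℕ} (h : numRows μ ≤ n)
    (hi : n ≤ i) : μ.rowLen i = 0 := by
  by_contra h0
  have := (YoungDiagram.mem_iff_lt_rowLen (μ := μ) (i := i) (j := 0)).2 (Nat.pos_of_ne_zero h0)
  rw [YoungDiagram.mem_iff_lt_colLen] at this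
  unfold numRows at h
  omega

theorem extZero_rowLen {μ : YoungDiagram} {n : ℕ} (h : numRows μ ≤ n) (i : ℕ) :
    extZero (fun i : Fin n => μ.rowLen i) i = μ.rowLen i := by
  by_cases hi : i < n
  · rw [extZero_of_lt _ hi]
  · rw [extZero_of_le _ (not_lt.1 hi), rowLen_eq_zero_of_numRows_le h (not_lt.1 hi)]

theorem diagOf_rowLen {μ : YoungDiagram} {n : ℕ} (h : numRows μ ≤ n) :
    diagOf (fun i : Fin n => μ.rowLen i) = μ := by
  ext ⟨i, j⟩
  rw [YoungDiagram.mem_cells, YoungDiagram.mem_cells, mem_diagOf (rowLen_antitone μ n),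
    YoungDiagram.mem_iff_lt_rowLen, extZero_rowLen h]

theorem numRows_diagOf_le {n : ℕ} {f : Fin n → ℕ} (hf : Antitone f) : numRows (diagOf f) ≤ n := by
  by_contra h
  have := (YoungDiagram.mem_iff_lt_colLen (μ := diagOf f) (i := n) (j := 0)).2 (not_le.1 h)
  rw [mem_diagOf hf, extZero_of_le f le_rfl] at this
  omega

theorem card_eq_sum_rowLen {μ : YoungDiagram} {n : ℕ} (h : numRows μ ≤ n) :
    μ.card = ∑ i : Fin n, μ.rowLen i := by
  have h1 : μ.card = ∑ i ∈ Finset.range n, (μ.row i).card := by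
    apply Finset.card_eq_sum_card_fiberwise (f := Prod.fst)
    rintro ⟨i, j⟩ hc
    have hc' : (i, j) ∈ μ := hc
    simp only [Finset.coe_range, Set.mem_Iio]
    by_contra hi
    rw [YoungDiagram.mem_iff_lt_rowLen, rowLen_eq_zero_of_numRows_le h (not_lt.1 hi)] at hc'
    omega
  rw [h1, Finset.sum_range]
  exact Finset.sum_congr rfl fun i _ => (μ.rowLen_eq_card).symm

theorem oddCols_eq_sum {μ : YoungDiagram} {l : ℕ} (h : numRows μ ≤ 2 * l + 1) :
    oddCols μ = ∑ q ∈ Finset.range (l + 1), (μ.rowLen (2 * q) - μ.rowLen (2 * q + 1)) := by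
  have h1 : ((Finset.range μ.card).filter fun j => Odd (μ.colLen j)) =
      (Finset.range (l + 1)).biUnion
        fun q => Finset.Ico (μ.rowLen (2 * q + 1)) (μ.rowLen (2 * q)) := by
    ext j
    have key : ∀ q, (j < μ.rowLen (2 * q) ∧ μ.rowLen (2 * q + 1) ≤ j) ↔
        μ.colLen j = 2 * q + 1 := by
      intro q
      rw [← YoungDiagram.mem_iff_lt_rowLen, ← not_lt, ← YoungDiagram.mem_iff_lt_rowLen,
        YoungDiagram.mem_iff_lt_colLen, YoungDiagram.mem_iff_lt_colLen]
      omega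
    simp only [Finset.mem_filter, Finset.mem_range, Finset.mem_biUnion, Finset.mem_Ico]
    constructor
    · rintro ⟨-, q, hq⟩
      refine ⟨q, ?_, ((key q).2 hq).symm⟩
      have := μ.colLen_anti 0 j (Nat.zero_le _)
      unfold numRows at h
      omega
    · rintro ⟨q, -, hq⟩
      have hc := (key q).1 hq.symm
      refine ⟨?_, q, hc⟩
      have h0 : j < μ.rowLen 0 := lt_of_lt_of_le hq.2 (μ.rowLen_anti _ _ (Nat.zero_le _))
      rw [μ.rowLen_eq_card] at h0
      exact lt_of_lt_of_le h0 (Finset.card_le_card (Finset.filter_subset _ _))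
  unfold oddCols
  rw [h1, Finset.card_biUnion]
  · exact Finset.sum_congr rfl fun q _ => Nat.card_Ico _ _
  · intro p _ q _ hpq
    rw [Function.onFun, Finset.disjoint_left]
    intro j hp hq
    simp only [Finset.mem_Ico] at hp hq
    rcases lt_or_gt_of_ne hpq with h' | h'
    · have := μ.rowLen_anti (2 * p + 1) (2 * q) (by omega)
      omega
    · have := μ.rowLen_anti (2 * q + 1) (2 * p) (by omega)
      omega

/-- The set of row length sequences `g` such that `f / g` is a horizontal strip. -/
def strips {n : ℕ} (f : Fin n → ℕ) : Finset (Fin n → ℕ) :=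
  Fintype.piFinset fun i => Finset.Icc (extZero f (i + 1)) (f i)

theorem antitone_of_mem_strips {n : ℕ} {f g : Fin n → ℕ} (hf : Antitone f) (hg : g ∈ strips f) :
    Antitone g := by
  simp only [strips, Fintype.mem_piFinset, Finset.mem_Icc] at hg
  intro i j hij
  rcases eq_or_lt_of_le hij with rfl | h
  · exact le_rfl
  · refine (hg j).2.trans (le_trans ?_ (hg i).1)
    rw [← extZero_val f j]
    exact extZero_antitone hf h

theorem extZero_le_of_mem_strips {n : ℕ} {f g : Fin n → ℕ} (hg : g ∈ strips f) (i : ℕ) :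
    extZero g i ≤ extZero f i := by
  simp only [strips, Fintype.mem_piFinset, Finset.mem_Icc] at hg
  by_cases hi : i < n
  · rw [extZero_of_lt _ hi, extZero_of_lt _ hi]
    exact (hg _).2
  · rw [extZero_of_le _ (not_lt.1 hi)]
    exact Nat.zero_le _

theorem extZero_succ_le_of_mem_strips {n : ℕ} {f g : Fin n → ℕ} (hg : g ∈ strips f) (i : ℕ) :
    extZero f (i + 1) ≤ extZero g i := by
  simp only [strips, Fintype.mem_piFinset, Finset.mem_Icc] at hg
  by_cases hi : i < n
  · rw [extZero_of_lt g hi]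
    exact (hg ⟨i, hi⟩).1
  · rw [extZero_of_le f (by omega)]
    exact Nat.zero_le _

/-- Fill the horizontal strip `f / g` with the letter `N + 1`. -/
def extendTableau {n : ℕ} {f g : Fin n → ℕ} (N : ℕ) (hf : Antitone f) (hg : g ∈ strips f)
    (S : SSYTN N (diagOf g)) : SSYTN (N + 1) (diagOf f) := by
  have hga := antitone_of_mem_strips hf hg
  have hSle : ∀ {i j}, j < extZero g i → 1 ≤ S.1 i j ∧ S.1 i j ≤ N := fun {i j} h => by
    have := S.2 i j ((mem_diagOf hga).2 h)
    rwa [Finset.mem_Icc] at this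
  exact ⟨{
    entry := fun i j => if j < extZero g i then S.1 i j else if j < extZero f i then N + 1 else 0
    row_weak' := by
      intro i j1 j2 hj h
      rw [mem_diagOf hf] at h
      by_cases h2 : j2 < extZero g i
      · rw [if_pos h2, if_pos (hj.trans h2)]
        exact S.1.row_weak hj ((mem_diagOf hga).2 h2)
      · rw [if_neg h2, if_pos h]
        by_cases h1 : j1 < extZero g i
        · rw [if_pos h1]
          have := hSle h1
          omega
        · rw [if_neg h1, if_pos (hj.trans h)]
    col_strict' := by
      intro i1 i2 j hi h
      rw [mem_diagOf hf] at h
      have h1 : j < extZero g i1 :=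
        lt_of_lt_of_le (lt_of_lt_of_le h (extZero_antitone hf hi))
          (extZero_succ_le_of_mem_strips hg i1)
      rw [if_pos h1]
      by_cases h2 : j < extZero g i2
      · rw [if_pos h2]
        exact S.1.col_strict hi ((mem_diagOf hga).2 h2)
      · rw [if_neg h2, if_pos h]
        have := hSle h1
        omega
    zeros' := by
      intro i j h
      rw [mem_diagOf hf] at h
      have h1 : ¬ j < extZero g i := fun h' =>
        h (lt_of_lt_of_le h' (extZero_le_of_mem_strips hg i))
      rw [if_neg h1, if_neg h] }, by
    intro i j h
    rw [mem_diagOf hf] at h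
    change (if j < extZero g i then S.1 i j else if j < extZero f i then N + 1 else 0) ∈ _
    rw [Finset.mem_Icc]
    by_cases h1 : j < extZero g i
    · rw [if_pos h1]
      have := hSle h1
      omega
    · rw [if_neg h1, if_pos h]
      omega⟩

theorem extendTableau_apply {n : ℕ} {f g : Fin n → ℕ} (N : ℕ) (hf : Antitone f) (hg : g ∈ strips f)
    (S : SSYTN N (diagOf g)) (i j : ℕ) :
    (extendTableau N hf hg S).1 i j =
      if j < extZero g i then S.1 i j else if j < extZero f i then N + 1 else 0 := rfl

theorem extendTableau_le_iff {n : ℕ} {f g : Fin n → ℕ} (N : ℕ) (hf : Antitone f)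
    (hg : g ∈ strips f) (S : SSYTN N (diagOf g)) {i j : ℕ} (h : j < extZero f i) :
    (extendTableau N hf hg S).1 i j ≤ N ↔ j < extZero g i := by
  rw [extendTableau_apply]
  by_cases h1 : j < extZero g i
  · rw [if_pos h1]
    have := S.2 i j ((mem_diagOf (antitone_of_mem_strips hf hg)).2 h1)
    rw [Finset.mem_Icc] at this
    exact iff_of_true this.2 h1
  · rw [if_neg h1, if_pos h]
    exact iff_of_false (by omega) h1

theorem extendTableau_bijective {n : ℕ} {f : Fin n → ℕ} (N : ℕ) (hf : Antitone f) :
    Function.Bijective fun p : (Σ g : strips f, SSYTN N (diagOf g.1)) =>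
      extendTableau N hf p.1.2 p.2 := by
  constructor
  · rintro ⟨⟨g, hg⟩, S⟩ ⟨⟨g', hg'⟩, S'⟩ h
    have h' : extendTableau N hf hg S = extendTableau N hf hg' S' := h
    have hgg : g = g' := by
      funext i
      have hmem : ∀ j, j < extZero g i ↔ j < extZero g' i := by
        intro j
        by_cases hj : j < extZero f i
        · rw [← extendTableau_le_iff N hf hg S hj, ← extendTableau_le_iff N hf hg' S' hj, h']
        · have h1 := extZero_le_of_mem_strips hg i
          have h2 := extZero_le_of_mem_strips hg' i
          constructor <;> intro <;> omega
      have := eq_of_forall_lt_iff hmem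
      rwa [extZero_val, extZero_val] at this
    subst hgg
    have hS : S = S' := by
      apply Subtype.ext
      ext i j
      by_cases hj : j < extZero g i
      · have e : (extendTableau N hf hg S).1 i j = (extendTableau N hf hg' S').1 i j := by rw [h']
        rwa [extendTableau_apply, extendTableau_apply, if_pos hj, if_pos hj] at e
      · have hga := antitone_of_mem_strips hf hg
        rw [S.1.zeros (by rwa [mem_diagOf hga]), S'.1.zeros (by rwa [mem_diagOf hga])]
    rw [hS]
  · rintro ⟨T, hT⟩
    simp only [mem_diagOf hf, Finset.mem_Icc] at hT
    let g : Fin n → ℕ := fun i => ((Finset.range (f i)).filter fun j => T i j ≤ N).card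
    have hgT : ∀ i j, j < extZero g i ↔ j < extZero f i ∧ T i j ≤ N := by
      intro i j
      by_cases hi : i < n
      · rw [extZero_of_lt _ hi, extZero_of_lt _ hi]
        have hlow : ∃ k ≤ f ⟨i, hi⟩,
            (Finset.range (f ⟨i, hi⟩)).filter (fun j => T i j ≤ N) = Finset.range k := by
          refine ⟨Nat.findGreatest (fun k => ∀ j < k, T i j ≤ N) (f ⟨i, hi⟩),
            Nat.findGreatest_le _, ?_⟩
          ext j
          simp only [Finset.mem_filter, Finset.mem_range]
          constructor
          · rintro ⟨h1, h2⟩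
            refine Nat.le_findGreatest (P := fun k => ∀ j < k, T i j ≤ N) (by omega) ?_
            intro j' hj'
            refine le_trans (T.row_weak_of_le (Nat.lt_succ_iff.1 hj') ?_) h2
            rw [mem_diagOf hf, extZero_of_lt _ hi]
            exact h1
          · intro h
            refine ⟨lt_of_lt_of_le h (Nat.findGreatest_le _), ?_⟩
            exact Nat.findGreatest_spec (P := fun k => ∀ j < k, T i j ≤ N) (Nat.zero_le _)
              (by intro j hj; omega) j h
        obtain ⟨k, hk, hk'⟩ := hlow
        have : g ⟨i, hi⟩ = k := by
          change ((Finset.range (f ⟨i, hi⟩)).filter (fun j => T i j ≤ N)).card = k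
          rw [hk', Finset.card_range]
        rw [this, ← Finset.mem_range, ← hk', Finset.mem_filter, Finset.mem_range]
      · rw [extZero_of_le _ (not_lt.1 hi), extZero_of_le _ (not_lt.1 hi)]
        simp
    have hg : g ∈ strips f := by
      simp only [strips, Fintype.mem_piFinset, Finset.mem_Icc]
      intro i
      constructor
      · rw [← extZero_val g]
        apply le_of_forall_lt
        intro j hj
        rw [hgT]
        refine ⟨lt_of_lt_of_le hj (extZero_antitone hf (Nat.le_succ _)), ?_⟩
        have h1 := T.col_strict (Nat.lt_add_one (i : ℕ)) ((mem_diagOf hf).2 hj)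
        have h2 := (hT _ _ hj).2
        omega
      · exact (Finset.card_filter_le _ _).trans (by simp)
    have hga := antitone_of_mem_strips hf hg
    refine ⟨⟨⟨g, hg⟩, ⟨{
      entry := fun i j => if j < extZero g i then T i j else 0
      row_weak' := ?_
      col_strict' := ?_
      zeros' := ?_ }, ?_⟩⟩, ?_⟩
    · intro i j1 j2 hj h
      rw [mem_diagOf hga] at h
      rw [if_pos h, if_pos (hj.trans h)]
      exact T.row_weak hj ((mem_diagOf hf).2 ((hgT _ _).1 h).1)
    · intro i1 i2 j hi h
      rw [mem_diagOf hga] at h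
      rw [if_pos h, if_pos (lt_of_lt_of_le h (extZero_antitone hga hi.le))]
      exact T.col_strict hi ((mem_diagOf hf).2 ((hgT _ _).1 h).1)
    · intro i j h
      rw [mem_diagOf hga] at h
      rw [if_neg h]
    · intro i j h
      rw [mem_diagOf hga] at h
      change (if j < extZero g i then T i j else 0) ∈ _
      rw [if_pos h, Finset.mem_Icc]
      have h' := (hgT _ _).1 h
      exact ⟨(hT _ _ h'.1).1, h'.2⟩
    · apply Subtype.ext
      ext i j
      change (if j < extZero g i then (if j < extZero g i then T i j else 0)
        else if j < extZero f i then N + 1 else 0) = T i j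
      by_cases h : j < extZero g i
      · rw [if_pos h, if_pos h]
      · rw [if_neg h]
        by_cases hj : j < extZero f i
        · rw [if_pos hj]
          have h1 := (hT _ _ hj).2
          have h2 : ¬ T i j ≤ N := fun h2 => h ((hgT _ _).2 ⟨hj, h2⟩)
          omega
        · rw [if_neg hj, T.zeros (by rwa [mem_diagOf hf])]

instance finite_SSYTN (N : ℕ) (μ : YoungDiagram) : Finite (SSYTN N μ) := by
  refine Finite.of_injective
    (fun (T : SSYTN N μ) (c : μ.cells) => (⟨T.1 c.1.1 c.1.2, by
      have := T.2 c.1.1 c.1.2 c.2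
      rw [Finset.mem_Icc] at this
      omega⟩ : Fin (N + 1))) ?_
  intro T T' h
  apply Subtype.ext
  ext i j
  by_cases hc : (i, j) ∈ μ
  · have := congrFun h ⟨(i, j), hc⟩
    simpa using this
  · rw [T.1.zeros hc, T'.1.zeros hc]

theorem dCount_succ {n : ℕ} {f : Fin n → ℕ} (N : ℕ) (hf : Antitone f) :
    dCount (N + 1) (diagOf f) = ∑ g ∈ strips f, dCount N (diagOf g) := by
  unfold dCount
  rw [← Nat.card_eq_of_bijective _ (extendTableau_bijective N hf), Nat.card_sigma]
  exact Finset.sum_coe_sort (strips f) fun g => Nat.card (SSYTN N (diagOf g))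

theorem dCount_zero {n : ℕ} {f : Fin n → ℕ} (hf : Antitone f) :
    dCount 0 (diagOf f) = if f = 0 then 1 else 0 := by
  split_ifs with h
  · subst h
    unfold dCount
    rw [Nat.card_eq_one_iff_unique]
    have hmem : ∀ i j, (i, j) ∉ diagOf (0 : Fin n → ℕ) := by
      intro i j
      rw [mem_diagOf hf]
      unfold extZero
      split_ifs <;> simp
    refine ⟨⟨fun T T' => ?_⟩, ⟨⟨⟨fun _ _ => 0, fun _ _ => le_rfl, fun _ h => absurd h (hmem _ _),
      fun _ => rfl⟩, fun i j h => absurd h (hmem _ _)⟩⟩⟩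
    apply Subtype.ext
    ext i j
    rw [T.1.zeros (hmem i j), T'.1.zeros (hmem i j)]
  · unfold dCount
    rw [Nat.card_eq_zero]
    left
    refine ⟨fun T => h ?_⟩
    funext i
    by_contra hi
    have := T.2 i 0 ((mem_diagOf hf).2 (by rw [extZero_val]; exact Nat.pos_of_ne_zero hi))
    simp at this

/-- The coefficients of `(1 - t z)⁻ᴺ`, extended by zero to negative indices. -/
def binomCoeff (N : ℕ) (t : ℝ) (k : ℤ) : ℝ :=
  if 0 ≤ k then (N.multichoose k.toNat : ℝ) * t ^ k.toNat else 0

theorem binomCoeff_of_neg (N : ℕ) (t : ℝ) {k : ℤ} (h : k < 0) : binomCoeff N t k = 0 :=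
  if_neg (by omega)

theorem binomCoeff_natCast (N : ℕ) (t : ℝ) (k : ℕ) :
    binomCoeff N t k = (N.multichoose k : ℝ) * t ^ k := by
  simp [binomCoeff]

theorem binomCoeff_zero (t : ℝ) (k : ℤ) : binomCoeff 0 t k = if k = 0 then 1 else 0 := by
  rcases lt_or_ge k 0 with h | h
  · rw [binomCoeff_of_neg _ _ h, if_neg (by omega)]
  · obtain ⟨k, rfl⟩ := Int.eq_ofNat_of_zero_le h
    rw [binomCoeff_natCast]
    cases k with
    | zero => simp
    | succ k => rw [Nat.multichoose_zero_succ, if_neg (by omega)]; simp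

theorem binomCoeff_succ (N : ℕ) (t : ℝ) (k : ℤ) :
    binomCoeff (N + 1) t k = binomCoeff N t k + t * binomCoeff (N + 1) t (k - 1) := by
  rcases lt_or_ge k 0 with h | h
  · rw [binomCoeff_of_neg _ _ h, binomCoeff_of_neg _ _ h, binomCoeff_of_neg _ _ (by omega)]
    simp
  · obtain ⟨k, rfl⟩ := Int.eq_ofNat_of_zero_le h
    cases k with
    | zero =>
      rw [binomCoeff_of_neg _ _ (show ((0 : ℕ) : ℤ) - 1 < 0 by simp), binomCoeff_natCast,
        binomCoeff_natCast]
      simp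
    | succ k =>
      have : ((k + 1 : ℕ) : ℤ) - 1 = (k : ℕ) := by push_cast; ring
      rw [this, binomCoeff_natCast, binomCoeff_natCast, binomCoeff_natCast,
        Nat.multichoose_succ_succ]
      push_cast
      ring

theorem sum_Icc_binomCoeff (N : ℕ) (t : ℝ) (d : ℤ) {a b : ℕ} (h : a ≤ b) :
    ∑ x ∈ Finset.Icc a b, t ^ (b - x) * binomCoeff N t (x + d) =
      binomCoeff (N + 1) t (b + d) - t ^ (b + 1 - a) * binomCoeff (N + 1) t (a - 1 + d) := by
  induction b, h using Nat.le_induction with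
  | base =>
    have h1 := binomCoeff_succ N t (a + d)
    have h2 : (a : ℤ) + d - 1 = a - 1 + d := by ring
    rw [h2] at h1
    simp [h1]
  | succ b hab ih =>
    have h1 := binomCoeff_succ N t (((b + 1 : ℕ) : ℤ) + d)
    have h2 : ((b + 1 : ℕ) : ℤ) + d - 1 = b + d := by push_cast; ring
    rw [h2] at h1
    rw [← Finset.insert_Icc_right_eq_Icc_add_one (by omega), Finset.sum_insert (by simp)]
    have h3 : ∑ x ∈ Finset.Icc a b, t ^ (b + 1 - x) * binomCoeff N t (x + d) =
        t * ∑ x ∈ Finset.Icc a b, t ^ (b - x) * binomCoeff N t (x + d) := by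
      rw [Finset.mul_sum]
      refine Finset.sum_congr rfl fun x hx => ?_
      rw [Finset.mem_Icc] at hx
      rw [show b + 1 - x = (b - x) + 1 by omega]
      ring
    rw [h3, ih, h1, show b + 1 + 1 - a = (b + 1 - a) + 1 by omega, Nat.sub_self]
    ring

theorem det_one_add_mul_of_upper {n : ℕ} (L A : Matrix (Fin n) (Fin n) ℝ)
    (hL : ∀ i k, k ≤ i → L i k = 0) : ((1 + L) * A).det = A.det := by
  rw [Matrix.det_mul, Matrix.det_of_isUpperTriangular, Finset.prod_eq_one, one_mul]
  · intro i _
    simp [hL i i le_rfl]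
  · intro i j hij
    have hij' : j < i := hij
    simp [hL i j hij'.le, Matrix.one_apply_ne hij'.ne']

theorem det_one_add_mul_of_lower {n : ℕ} (L A : Matrix (Fin n) (Fin n) ℝ)
    (hL : ∀ i k, i ≤ k → L i k = 0) : ((1 + L) * A).det = A.det := by
  rw [Matrix.det_mul, Matrix.det_of_isLowerTriangular, Finset.prod_eq_one, one_mul]
  · intro i _
    simp [hL i i le_rfl]
  · intro i j hij
    have hij' : i < j := hij
    simp [hL i j hij'.le, Matrix.one_apply_ne hij'.ne]

theorem det_sum_smul_rows {n : ℕ} (s : Fin n → Finset ℕ) (w : Fin n → ℕ → ℝ)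
    (M : Fin n → ℕ → Fin n → ℝ) :
    (Matrix.of fun i j => ∑ x ∈ s i, w i x * M i x j).det =
      ∑ a ∈ Fintype.piFinset s, (∏ i, w i (a i)) * (Matrix.of fun i j => M i (a i) j).det := by
  have h := (Matrix.detRowAlternating (R := ℝ) (n := Fin n)).toMultilinearMap.map_sum_finset
    (fun i x => w i x • M i x) s
  have h1 : (fun i => ∑ x ∈ s i, w i x • M i x) =
      Matrix.of fun i j => ∑ x ∈ s i, w i x * M i x j := by
    ext i j
    simp [Finset.sum_apply]
  rw [h1] at h
  refine h.trans (Finset.sum_congr rfl fun a _ => ?_)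
  exact MultilinearMap.map_smul_univ _ (fun i => w i (a i)) fun i => M i (a i)

/-- The Jacobi–Trudi matrix of `f` at `x₁ = ⋯ = x_N = t`. -/
def jacobiTrudi (N : ℕ) (t : ℝ) {n : ℕ} (f : Fin n → ℕ) : Matrix (Fin n) (Fin n) ℝ :=
  Matrix.of fun i j => binomCoeff N t ((f i : ℤ) + ((j : ℤ) - i))

theorem det_jacobiTrudi_zero (t : ℝ) {n : ℕ} {f : Fin n → ℕ} (hf : Antitone f) :
    (jacobiTrudi 0 t f).det = if f = 0 then 1 else 0 := by
  split_ifs with h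
  · subst h
    have : jacobiTrudi 0 t (0 : Fin n → ℕ) = 1 := by
      ext i j
      rw [jacobiTrudi, Matrix.of_apply, binomCoeff_zero, Matrix.one_apply]
      congr 1
      simp only [Pi.zero_apply, eq_iff_iff, Fin.ext_iff]
      omega
    rw [this, Matrix.det_one]
  · cases n with
    | zero => exact absurd (Subsingleton.elim _ _) h
    | succ n =>
      apply Matrix.det_eq_zero_of_row_eq_zero 0
      intro j
      have h0 : f 0 ≠ 0 := by
        intro h0
        apply h
        funext i
        have := hf (Fin.zero_le i)
        simp only [Pi.zero_apply]
        omega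
      rw [jacobiTrudi, Matrix.of_apply, binomCoeff_zero, if_neg]
      simp only [Fin.val_zero]
      omega

theorem det_jacobiTrudi_succ (N : ℕ) (t : ℝ) {n : ℕ} {f : Fin n → ℕ} (hf : Antitone f) :
    (jacobiTrudi (N + 1) t f).det =
      ∑ g ∈ strips f, (∏ i, t ^ (f i - g i)) * (jacobiTrudi N t g).det := by
  have hle : ∀ i : Fin n, extZero f (i + 1) ≤ f i := fun i => by
    rw [← extZero_val f i]
    exact extZero_antitone hf (Nat.le_succ _)
  let L : Matrix (Fin n) (Fin n) ℝ := Matrix.of fun i k =>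
    if (k : ℕ) = i + 1 then - t ^ (f i + 1 - extZero f (i + 1)) else 0
  rw [← det_one_add_mul_of_upper L]
  · have h := det_sum_smul_rows
      (fun i : Fin n => Finset.Icc (extZero f (i + 1)) (f i)) (fun i x => t ^ (f i - x))
      (fun i x j => binomCoeff N t ((x : ℤ) + ((j : ℤ) - i)))
    refine Eq.trans ?_ h
    congr 1
    ext i j
    simp only [Matrix.of_apply]
    rw [sum_Icc_binomCoeff _ _ _ (hle i), Matrix.add_mul, Matrix.one_mul, Matrix.add_apply,
      sub_eq_add_neg]
    congr 1
    rw [Matrix.mul_apply]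
    by_cases hi : (i : ℕ) + 1 < n
    · rw [Finset.sum_eq_single (⟨i + 1, hi⟩ : Fin n)]
      · simp only [L, Matrix.of_apply, jacobiTrudi, if_true, extZero_of_lt f hi, neg_mul]
        congr 3
        push_cast
        ring
      · intro k _ hk
        have : (k : ℕ) ≠ i + 1 := fun h => hk (Fin.ext h)
        simp [L, this]
      · simp
    · rw [Finset.sum_eq_zero]
      · rw [extZero_of_le f (not_lt.1 hi), binomCoeff_of_neg _ _ (by push_cast; omega)]
        simp
      · intro k _
        have : (k : ℕ) ≠ i + 1 := by omega
        simp [L, this]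
  · intro i k hik
    have : (k : ℕ) ≠ i + 1 := by
      have : (k : ℕ) ≤ i := hik
      omega
    simp [L, this]

theorem dCount_mul_pow_eq_det (N : ℕ) (t : ℝ) {n : ℕ} {f : Fin n → ℕ} (hf : Antitone f) :
    t ^ (∑ i, f i) * (dCount N (diagOf f) : ℝ) = (jacobiTrudi N t f).det := by
  induction N generalizing f with
  | zero =>
    rw [det_jacobiTrudi_zero t hf, dCount_zero hf]
    split_ifs with h
    · simp [h]
    · simp
  | succ N ih =>
    rw [det_jacobiTrudi_succ N t hf, dCount_succ N hf]
    push_cast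
    rw [Finset.mul_sum]
    refine Finset.sum_congr rfl fun g hg => ?_
    rw [← ih (antitone_of_mem_strips hf hg), ← mul_assoc]
    congr 1
    rw [Finset.prod_pow_eq_pow_sum, ← pow_add]
    congr 1
    rw [← Finset.sum_add_distrib]
    refine Finset.sum_congr rfl fun i _ => ?_
    have := extZero_le_of_mem_strips hg i
    rw [extZero_val, extZero_val] at this
    omega

theorem extZero_lt_of_lt {l : ℕ} {b : Fin l → ℕ} (hb : StrictAnti b) {i j : ℕ} (hij : i < j)
    (hj : j < l) : extZero b j < extZero b i := by
  rw [extZero_of_lt b hj, extZero_of_lt b (hij.trans hj)]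
  exact hb hij

/-- The weighted tail `∑_{a ≤ x < K} β^(x - a) m(x - r)`. -/
def tailSum (β : ℝ) (m : ℤ → ℝ) (K a : ℕ) (r : ℤ) : ℝ :=
  ∑ x ∈ Finset.Ico a K, β ^ (x - a) * m (x - r)

theorem sum_Ico_eq_tailSum_sub (β : ℝ) (m : ℤ → ℝ) {K a c : ℕ} (h : a ≤ c) (hc : c ≤ K) (r : ℤ) :
    ∑ x ∈ Finset.Ico a c, β ^ (x - a) * m (x - r) =
      tailSum β m K a r - β ^ (c - a) * tailSum β m K c r := by
  unfold tailSum
  rw [← Finset.sum_Ico_consecutive _ h hc, Finset.mul_sum, eq_sub_iff_add_eq]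
  congr 1
  refine Finset.sum_congr rfl fun x hx => ?_
  rw [Finset.mem_Ico] at hx
  rw [← mul_assoc, ← pow_add]
  congr 2
  omega

theorem tailSum_eq_add (β : ℝ) (m : ℤ → ℝ) {K a : ℕ} (h : a < K) (r : ℤ) :
    tailSum β m K a r = m (a - r) + β * tailSum β m K (a + 1) r := by
  have := sum_Ico_eq_tailSum_sub β m (Nat.le_succ a) h r
  rw [Nat.succ_eq_add_one, Nat.Ico_succ_singleton] at this
  simp only [Finset.sum_singleton, Nat.sub_self, pow_zero, one_mul, Nat.add_sub_cancel_left,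
    pow_one] at this
  linarith

/-- Lower bound for the entry in even position `i`, given the entries `b` in odd positions. -/
def lowerEnd {l : ℕ} (b : Fin l → ℕ) (i : ℕ) : ℕ :=
  if i / 2 < l then extZero b (i / 2) + 1 else 0

/-- Strict upper bound for the entry in even position `i`, given the entries `b` in odd
positions. -/
def upperEnd {l : ℕ} (K : ℕ) (b : Fin l → ℕ) (i : ℕ) : ℕ :=
  if i = 0 then K else extZero b (i / 2 - 1)

theorem lowerEnd_le_upperEnd {l K : ℕ} {b : Fin l → ℕ} (hb : StrictAnti b) (hK : ∀ j, b j < K)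
    {i : ℕ} (hi : i % 2 = 0) : lowerEnd b i ≤ upperEnd K b i := by
  unfold lowerEnd upperEnd
  split_ifs with h1 h2 h2
  · rw [extZero_of_lt b h1]
    exact hK _
  · exact extZero_lt_of_lt hb (by omega) h1
  · exact Nat.zero_le _
  · exact Nat.zero_le _

/-- The rows of the matrix obtained by summing over the entries in even positions. -/
def tailMatrix (β : ℝ) (m : ℤ → ℝ) {l : ℕ} (K : ℕ) (b : Fin l → ℕ) :
    Matrix (Fin (2 * l + 1)) (Fin (2 * l + 1)) ℝ :=
  Matrix.of fun i j =>
    if (i : ℕ) % 2 = 0 then tailSum β m K (lowerEnd b i) (2 * l - j)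
    else m (extZero b (i / 2) - (2 * l - j))

/-- The range of the entry in position `i`, given the entries `b` in odd positions. -/
def entryRange {l : ℕ} (K : ℕ) (b : Fin l → ℕ) (i : Fin (2 * l + 1)) : Finset ℕ :=
  if (i : ℕ) % 2 = 0 then Finset.Ico (lowerEnd b i) (upperEnd K b i) else {extZero b (i / 2)}

/-- The power of `β` attached to the entry `x` in position `i`. -/
def entryWeight (β : ℝ) {l : ℕ} (b : Fin l → ℕ) (i : Fin (2 * l + 1)) (x : ℕ) : ℝ :=
  if (i : ℕ) % 2 = 0 then β ^ (x - lowerEnd b i) else 1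

/-- The matrix with rows indexed by the entries of `a`. -/
def rowMatrix (m : ℤ → ℝ) {l : ℕ} (a : Fin (2 * l + 1) → ℕ) :
    Matrix (Fin (2 * l + 1)) (Fin (2 * l + 1)) ℝ :=
  Matrix.of fun i j => m (a i - (2 * l - j))

theorem det_tailMatrix (β : ℝ) (m : ℤ → ℝ) {l K : ℕ} {b : Fin l → ℕ} (hb : StrictAnti b)
    (hK : ∀ j, b j < K) :
    (tailMatrix β m K b).det =
      ∑ a ∈ Fintype.piFinset (entryRange K b),
        (∏ i, entryWeight β b i (a i)) * (rowMatrix m a).det := by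
  let L : Matrix (Fin (2 * l + 1)) (Fin (2 * l + 1)) ℝ := Matrix.of fun i k =>
    (if (i : ℕ) % 2 = 0 ∧ (k : ℕ) + 1 = i then
      - β ^ (upperEnd K b i - lowerEnd b i) else 0) +
    (if (i : ℕ) % 2 = 0 ∧ (k : ℕ) + 2 = i then
      - (β ^ (upperEnd K b i - lowerEnd b i) * β) else 0)
  rw [← det_one_add_mul_of_lower L]
  · have h := det_sum_smul_rows (entryRange K b) (entryWeight β b)
      (fun _ x (j : Fin (2 * l + 1)) => m ((x : ℤ) - (2 * l - j)))
    refine Eq.trans ?_ h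
    congr 1
    ext i j
    rw [Matrix.add_mul, Matrix.one_mul, Matrix.add_apply, Matrix.mul_apply]
    simp only [Matrix.of_apply, L, add_mul, Finset.sum_add_distrib]
    by_cases hi : (i : ℕ) % 2 = 0
    · by_cases hi0 : (i : ℕ) = 0
      · rw [Finset.sum_eq_zero, Finset.sum_eq_zero, add_zero, add_zero]
        · simp only [tailMatrix, entryRange, entryWeight, Matrix.of_apply, hi0]
          simp [upperEnd, tailSum]
        · intro k _
          rw [if_neg (by omega), zero_mul]
        · intro k _
          rw [if_neg (by omega), zero_mul]
      · have hlt := i.2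
        rw [Finset.sum_eq_single (⟨i - 1, by omega⟩ : Fin (2 * l + 1)),
          Finset.sum_eq_single (⟨i - 2, by omega⟩ : Fin (2 * l + 1))]
        · rw [if_pos ⟨hi, by simp only; omega⟩, if_pos ⟨hi, by simp only; omega⟩]
          simp only [tailMatrix, entryRange, entryWeight, Matrix.of_apply, if_pos hi]
          have e1 : ¬ ((i : ℕ) - 1) % 2 = 0 := by omega
          have e2 : ((i : ℕ) - 2) % 2 = 0 := by omega
          have e3 : ((i : ℕ) - 1) / 2 = i / 2 - 1 := by omega
          have e4 : ((i : ℕ) - 2) / 2 = i / 2 - 1 := by omega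
          have e5 : (i : ℕ) / 2 - 1 < l := by omega
          have hup : upperEnd K b i = extZero b (i / 2 - 1) := if_neg hi0
          have hlow : lowerEnd b (i - 2) = extZero b (i / 2 - 1) + 1 := by
            unfold lowerEnd
            rw [e4, if_pos e5]
          have hupK : upperEnd K b i < K := by
            rw [hup, extZero_of_lt b e5]
            exact hK _
          rw [if_neg e1, if_pos e2, e3, hlow, ← hup,
            sum_Ico_eq_tailSum_sub β m (lowerEnd_le_upperEnd hb hK hi) hupK.le,
            tailSum_eq_add β m hupK]
          ring
        · intro k _ hk
          have : (k : ℕ) ≠ i - 2 := fun h => hk (Fin.ext h)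
          rw [if_neg (by omega), zero_mul]
        · simp
        · intro k _ hk
          have : (k : ℕ) ≠ i - 1 := fun h => hk (Fin.ext h)
          rw [if_neg (by omega), zero_mul]
        · simp
    · simp [hi, tailMatrix, entryRange, entryWeight]
  · intro i k hik
    have : (i : ℕ) ≤ k := hik
    simp only [L, Matrix.of_apply]
    rw [if_neg (by omega), if_neg (by omega), add_zero]

/-- The entries in odd positions. -/
def oddEntries {l : ℕ} (a : Fin (2 * l + 1) → ℕ) (j : Fin l) : ℕ := a ⟨2 * j + 1, by omega⟩

theorem extZero_oddEntries {l : ℕ} (a : Fin (2 * l + 1) → ℕ) {i : ℕ} (hi : i < l) :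
    extZero (oddEntries a) i = a ⟨2 * i + 1, by omega⟩ := extZero_of_lt _ hi

theorem mem_entryRange_iff {l K : ℕ} {b : Fin l → ℕ} (hK : ∀ j, b j < K)
    (hl : 0 < l) (a : Fin (2 * l + 1) → ℕ) :
    a ∈ Fintype.piFinset (entryRange K b) ↔
      (StrictAnti a ∧ ∀ i, a i < K) ∧ oddEntries a = b := by
  rw [Fintype.mem_piFinset]
  constructor
  · intro h
    have hodd : ∀ i : Fin (2 * l + 1), (i : ℕ) % 2 ≠ 0 → a i = extZero b (i / 2) := by
      intro i hi
      have := h i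
      rwa [entryRange, if_neg hi, Finset.mem_singleton] at this
    have heven : ∀ i : Fin (2 * l + 1), (i : ℕ) % 2 = 0 →
        lowerEnd b i ≤ a i ∧ a i < upperEnd K b i := by
      intro i hi
      have := h i
      rwa [entryRange, if_pos hi, Finset.mem_Ico] at this
    have hb : oddEntries a = b := by
      funext j
      have := hodd ⟨2 * j + 1, by omega⟩ (by simp only; omega)
      rw [oddEntries, this]
      simp only
      rw [show (2 * (j : ℕ) + 1) / 2 = j by omega, extZero_val]
    have hanti : StrictAnti a := by
      rw [Fin.strictAnti_iff_succ_lt]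
      intro i
      by_cases hi : (i : ℕ) % 2 = 0
      · have h1 := hodd i.succ (by rw [Fin.val_succ]; omega)
        have h2 := (heven i.castSucc hi).1
        rw [lowerEnd, Fin.val_castSucc, if_pos (by omega)] at h2
        rw [Fin.val_succ, show ((i : ℕ) + 1) / 2 = i / 2 by omega] at h1
        omega
      · have h1 := (heven i.succ (by rw [Fin.val_succ]; omega)).2
        have h2 := hodd i.castSucc hi
        rw [Fin.val_castSucc] at h2
        rw [upperEnd, Fin.val_succ, if_neg (by omega),
          show ((i : ℕ) + 1) / 2 - 1 = i / 2 by omega] at h1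
        omega
    refine ⟨⟨hanti, fun i => lt_of_le_of_lt (hanti.antitone (Fin.zero_le i)) ?_⟩, hb⟩
    have := (heven 0 (by simp)).2
    simpa [upperEnd] using this
  · rintro ⟨⟨hanti, hlt⟩, rfl⟩ i
    by_cases hi : (i : ℕ) % 2 = 0
    · rw [entryRange, if_pos hi, Finset.mem_Ico]
      constructor
      · rw [lowerEnd]
        split_ifs with h
        · rw [extZero_oddEntries a h]
          apply hanti
          rw [Fin.lt_def]
          simp only
          omega
        · exact Nat.zero_le _
      · rw [upperEnd]
        split_ifs with h
        · exact hlt i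
        · have := i.2
          rw [extZero_oddEntries a (by omega)]
          apply hanti
          rw [Fin.lt_def]
          simp only
          omega
    · have := i.2
      rw [entryRange, if_neg hi, Finset.mem_singleton, extZero_oddEntries a (by omega)]
      congr 1
      ext
      simp only
      omega

/-- Strictly decreasing sequences of length `n` with entries below `K`. -/
def strictSeqs (n K : ℕ) : Finset (Fin n → ℕ) :=
  (Fintype.piFinset fun _ => Finset.range K).filter StrictAnti

theorem mem_strictSeqs {n K : ℕ} {a : Fin n → ℕ} :
    a ∈ strictSeqs n K ↔ StrictAnti a ∧ ∀ i, a i < K := by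
  simp [strictSeqs, and_comm]

/-- The power of `β` attached to the strictly decreasing sequence `a`. -/
def seqWeight (β : ℝ) {l : ℕ} (a : Fin (2 * l + 1) → ℕ) : ℝ :=
  ∏ i, entryWeight β (oddEntries a) i (a i)

theorem sum_strictSeqs_eq (β : ℝ) (m : ℤ → ℝ) {l : ℕ} (hl : 0 < l) (K : ℕ) :
    ∑ a ∈ strictSeqs (2 * l + 1) K, seqWeight β a * (rowMatrix m a).det =
      ∑ b ∈ strictSeqs l K, (tailMatrix β m K b).det := by
  rw [← Finset.sum_fiberwise_of_maps_to (s := strictSeqs (2 * l + 1) K) (t := strictSeqs l K)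
    (g := oddEntries)]
  · refine Finset.sum_congr rfl fun b hb => ?_
    rw [mem_strictSeqs] at hb
    rw [det_tailMatrix β m hb.1 hb.2]
    refine Finset.sum_congr ?_ fun a ha => ?_
    · ext a
      rw [Finset.mem_filter, mem_strictSeqs, mem_entryRange_iff hb.2 hl]
    · rw [mem_entryRange_iff hb.2 hl] at ha
      rw [seqWeight, ha.2]
  · intro a ha
    rw [mem_strictSeqs] at ha ⊢
    refine ⟨fun i j hij => ha.1 ?_, fun i => ha.2 _⟩
    rw [Fin.lt_def] at hij ⊢
    simp only
    omega

theorem eq_one_of_strictAnti_comp {l : ℕ} {b : Fin l → ℕ} (hb : StrictAnti b)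
    {ρ : Equiv.Perm (Fin l)} (h : StrictAnti (b ∘ ρ)) : ρ = 1 := by
  have hρ : StrictMono ρ := fun i j hij => by
    have := h hij
    exact hb.lt_iff_gt.1 this
  have h2 : hρ.orderIsoOfSurjective ρ ρ.surjective = OrderIso.refl (Fin l) := Subsingleton.elim _ _
  ext i
  have := congrArg (fun e : Fin l ≃o Fin l => (e i : ℕ)) h2
  simpa using this

theorem sum_piFinset_eq_factorial_mul {l : ℕ} (Ψ : (Fin l → ℕ) → ℝ)
    (hperm : ∀ b (σ : Equiv.Perm (Fin l)), Ψ (b ∘ σ) = Ψ b)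
    (hinj : ∀ b, ¬ Function.Injective b → Ψ b = 0) (K : ℕ) :
    ∑ b ∈ Fintype.piFinset (fun _ : Fin l => Finset.range K), Ψ b =
      l.factorial * ∑ b ∈ strictSeqs l K, Ψ b := by
  have h1 : ∑ b ∈ Fintype.piFinset (fun _ : Fin l => Finset.range K), Ψ b =
      ∑ b ∈ (Fintype.piFinset (fun _ : Fin l => Finset.range K)).filter
        (Function.Injective), Ψ b := by
    rw [Finset.sum_filter]
    refine Finset.sum_congr rfl fun b _ => ?_
    split_ifs with h
    · rfl
    · exact hinj b h
  have h2 : ∑ p ∈ (Finset.univ : Finset (Equiv.Perm (Fin l))) ×ˢ strictSeqs l K, Ψ (p.2 ∘ p.1) =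
      l.factorial * ∑ b ∈ strictSeqs l K, Ψ b := by
    rw [Finset.sum_product]
    simp only [hperm]
    rw [Finset.sum_const, Finset.card_univ, Fintype.card_perm, Fintype.card_fin, nsmul_eq_mul]
  rw [h1, ← h2]
  symm
  refine Finset.sum_nbij (fun p => p.2 ∘ p.1) ?_ ?_ ?_ fun _ _ => rfl
  · rintro ⟨σ, b⟩ hb
    simp only [Finset.mem_product, Finset.mem_univ, true_and, mem_strictSeqs] at hb
    simp only [Finset.mem_filter, Fintype.mem_piFinset, Finset.mem_range, Function.comp_apply]
    exact ⟨fun i => hb.2 _, hb.1.injective.comp σ.injective⟩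
  · rintro ⟨σ, b⟩ hb ⟨σ', b'⟩ hb' heq
    simp only [Finset.coe_product, Set.mem_prod, Finset.mem_coe, mem_strictSeqs] at hb hb'
    have heq : b ∘ σ = b' ∘ σ' := heq
    have hb2 : b' = b ∘ (σ * σ'⁻¹ : Equiv.Perm (Fin l)) := by
      funext i
      have := congrFun heq (σ'⁻¹ i)
      simpa using this.symm
    have h := hb'.2.1
    rw [hb2] at h
    have h := eq_one_of_strictAnti_comp hb.2.1 h
    have hσ : σ = σ' := mul_inv_eq_one.1 h
    rw [h] at hb2
    rw [hσ]
    congr 1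
    exact hb2.symm
  · intro b hb
    simp only [Finset.coe_filter, Fintype.mem_piFinset, Finset.mem_range, Set.mem_ofPred_eq] at hb
    have hm : StrictMono (b ∘ Tuple.sort b) :=
      (Tuple.monotone_sort b).strictMono_of_injective (hb.2.comp (Tuple.sort b).injective)
    let ρ : Equiv.Perm (Fin l) := Fin.revPerm.trans (Tuple.sort b)
    refine ⟨(ρ⁻¹, b ∘ ρ), ?_, ?_⟩
    · simp only [Finset.coe_product, Set.mem_prod, Finset.mem_coe, mem_strictSeqs]
      refine ⟨Finset.mem_univ _, fun i j hij => ?_, fun i => hb.1 _⟩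
      exact hm (Fin.rev_lt_rev.2 hij)
    · funext i
      simp

/-- The signed sum over permutations underlying the Pfaffian of the alternating form
attached to a product of bilinear forms. -/
def pairingSum {l : ℕ} (F : Fin l → Fin l ⊕ Fin l → Fin l ⊕ Fin l → ℝ) : ℝ :=
  ∑ τ : Equiv.Perm (Fin l ⊕ Fin l),
    ((Equiv.Perm.sign τ : ℤ) : ℝ) * ∏ j, F j (τ (Sum.inl j)) (τ (Sum.inr j))

theorem pairingSum_eq_zero_of_symm {l : ℕ} {F : Fin l → Fin l ⊕ Fin l → Fin l ⊕ Fin l → ℝ}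
    (j : Fin l) (h : ∀ p q, F j p q = F j q p) : pairingSum F = 0 := by
  let s : Equiv.Perm (Fin l ⊕ Fin l) := Equiv.swap (Sum.inl j) (Sum.inr j)
  have key : pairingSum F = - pairingSum F := by
    conv_lhs => rw [pairingSum, ← Equiv.sum_comp (Equiv.mulRight s)]
    rw [pairingSum, ← Finset.sum_neg_distrib]
    refine Finset.sum_congr rfl fun τ _ => ?_
    rw [Equiv.coe_mulRight, Equiv.Perm.sign_mul, Equiv.Perm.sign_swap (by simp)]
    have : ∀ i, F i ((τ * s) (Sum.inl i)) ((τ * s) (Sum.inr i)) =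
        F i (τ (Sum.inl i)) (τ (Sum.inr i)) := by
      intro i
      rw [Equiv.Perm.mul_apply, Equiv.Perm.mul_apply]
      by_cases hi : i = j
      · subst hi
        rw [Equiv.swap_apply_left, Equiv.swap_apply_right, h]
      · rw [Equiv.swap_apply_of_ne_of_ne, Equiv.swap_apply_of_ne_of_ne] <;> simp [hi]
    simp only [this]
    push_cast
    ring
  linarith

theorem pairingSum_congr_of_skew_eq {l : ℕ} {A B : Fin l ⊕ Fin l → Fin l ⊕ Fin l → ℝ}
    (h : ∀ p q, A p q - A q p = B p q - B q p) :
    pairingSum (fun _ => A) = pairingSum (fun _ => B) := by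
  have key : ∀ s : Finset (Fin l),
      pairingSum (fun j => if j ∈ s then B else A) = pairingSum (fun _ => A) := by
    intro s
    induction s using Finset.induction_on with
    | empty => simp
    | insert j s hj ih =>
      rw [← ih]
      rw [← sub_eq_zero, ← pairingSum_eq_zero_of_symm
        (F := fun i => if i = j then B - A else if i ∈ s then B else A) j
        (fun p q => by simp only [if_true, Pi.sub_apply]; linarith [h p q])]
      simp only [pairingSum]
      rw [← Finset.sum_sub_distrib]
      refine Finset.sum_congr rfl fun τ _ => ?_
      rw [← mul_sub]
      congr 1
      rw [← Finset.mul_prod_erase _ _ (Finset.mem_univ j), ← Finset.mul_prod_erase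
        (f := fun i => (if i ∈ s then B else A) (τ (Sum.inl i)) (τ (Sum.inr i)))
        _ (Finset.mem_univ j), ← Finset.mul_prod_erase
        (f := fun i => (if i = j then B - A else if i ∈ s then B else A)
          (τ (Sum.inl i)) (τ (Sum.inr i))) _ (Finset.mem_univ j)]
      simp only [Finset.mem_insert, true_or, if_true, if_neg hj, Pi.sub_apply, sub_mul]
      congr 2
      · refine Finset.prod_congr rfl fun i hi => ?_
        rw [Finset.mem_erase] at hi
        simp [hi.1]
      · refine Finset.prod_congr rfl fun i hi => ?_
        rw [Finset.mem_erase] at hi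
        simp [hi.1]
  have := key Finset.univ
  simpa using this.symm

theorem pairingSum_block {l : ℕ} (S : Matrix (Fin l) (Fin l) ℝ) :
    pairingSum (fun _ => fun p q => Sum.elim (fun i => Sum.elim (fun _ => 0) (fun k => S i k) q)
      (fun _ => 0) p) = l.factorial * S.det := by
  set T : Fin l ⊕ Fin l → Fin l ⊕ Fin l → ℝ := fun p q =>
    Sum.elim (fun i => Sum.elim (fun _ => 0) (fun k => S i k) q) (fun _ => 0) p with hT
  have h1 : pairingSum (fun _ => T) = ∑ p : Equiv.Perm (Fin l) × Equiv.Perm (Fin l),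
      ((Equiv.Perm.sign p.1 : ℤ) : ℝ) * ((Equiv.Perm.sign p.2 : ℤ) : ℝ) *
        ∏ j, S (p.1 j) (p.2 j) := by
    symm
    rw [pairingSum]
    refine Finset.sum_of_injOn (fun σ => Equiv.Perm.sumCongr σ.fst σ.snd) ?_ ?_ ?_ ?_
    · intro σ₁ _ σ₂ _ h
      exact Equiv.Perm.sumCongrHom_injective (a₁ := σ₁) (a₂ := σ₂) h
    · intro _ _
      simp
    · intro τ _ hτ
      by_contra hne
      apply hτ
      have hne := right_ne_zero_of_mul hne
      rw [Finset.prod_ne_zero_iff] at hne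
      have hmem : τ ∈ (Equiv.Perm.sumCongrHom (Fin l) (Fin l)).range := by
        apply Equiv.Perm.mem_sumCongrHom_range_of_perm_mapsTo_inl
        rintro _ ⟨j, rfl⟩
        have := hne j (Finset.mem_univ _)
        rcases hx : τ (Sum.inl j) with i | i
        · exact ⟨i, rfl⟩
        · rw [hx] at this
          simp [hT] at this
      obtain ⟨σ, rfl⟩ := hmem
      exact ⟨σ, by simp, rfl⟩
    · rintro ⟨σ, ρ⟩ _
      simp [hT, Equiv.Perm.sign_sumCongr]
  rw [h1, Fintype.sum_prod_type]
  have h2 : ∀ σ : Equiv.Perm (Fin l), ∑ ρ : Equiv.Perm (Fin l),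
      ((Equiv.Perm.sign σ : ℤ) : ℝ) * ((Equiv.Perm.sign ρ : ℤ) : ℝ) * ∏ j, S (σ j) (ρ j) =
        S.det := by
    intro σ
    have := Matrix.det_permute σ S
    have hs : ((Equiv.Perm.sign σ : ℤ) : ℝ) * ((Equiv.Perm.sign σ : ℤ) : ℝ) = 1 := by
      rw [← Int.cast_mul, ← Units.val_mul, Int.units_mul_self]
      simp
    simp only [mul_assoc]
    rw [← Finset.mul_sum]
    have h3 : ∑ ρ : Equiv.Perm (Fin l), ((Equiv.Perm.sign ρ : ℤ) : ℝ) * ∏ j, S (σ j) (ρ j) =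
        (S.submatrix σ id).det := by
      rw [← Matrix.det_transpose, Matrix.det_apply']
      rfl
    rw [h3, this, ← mul_assoc, hs, one_mul]
  simp only [h2]
  rw [Finset.sum_const, Finset.card_univ, Fintype.card_perm, Fintype.card_fin, nsmul_eq_mul]

theorem pairingSum_eq_factorial_mul_det {l : ℕ} {A : Fin l ⊕ Fin l → Fin l ⊕ Fin l → ℝ}
    (hl : ∀ i j, A (Sum.inl i) (Sum.inl j) = A (Sum.inl j) (Sum.inl i))
    (hr : ∀ i j, A (Sum.inr i) (Sum.inr j) = A (Sum.inr j) (Sum.inr i)) :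
    pairingSum (fun _ => A) = l.factorial *
      (Matrix.of fun i j => A (Sum.inl i) (Sum.inr j) - A (Sum.inr j) (Sum.inl i)).det := by
  rw [← pairingSum_block]
  apply pairingSum_congr_of_skew_eq
  rintro (i | i) (j | j)
  · simp [hl i j]
  · simp
  · simp
  · simp [hr i j]

/-- The variant of `pairingSum` with an extra index paired with the linear form `v`. -/
def borderedPairingSum {l : ℕ} (A : Option (Fin l ⊕ Fin l) → Option (Fin l ⊕ Fin l) → ℝ)
    (v : Option (Fin l ⊕ Fin l) → ℝ) : ℝ :=
  ∑ τ : Equiv.Perm (Option (Fin l ⊕ Fin l)), ((Equiv.Perm.sign τ : ℤ) : ℝ) *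
    (v (τ none) * ∏ j, A (τ (some (Sum.inl j))) (τ (some (Sum.inr j))))

theorem borderedPairingSum_eq_mul {l : ℕ}
    {A : Option (Fin l ⊕ Fin l) → Option (Fin l ⊕ Fin l) → ℝ} {v : Option (Fin l ⊕ Fin l) → ℝ}
    (hv : ∀ p, v (some p) = 0) :
    borderedPairingSum A v = v none * pairingSum (fun _ p q => A (some p) (some q)) := by
  rw [borderedPairingSum, ← Equiv.sum_comp Equiv.Perm.decomposeOption.symm,
    Fintype.sum_prod_type, Fintype.sum_option, pairingSum, Finset.mul_sum]
  rw [Finset.sum_eq_zero (s := Finset.univ (α := Fin l ⊕ Fin l)), add_zero]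
  · refine Finset.sum_congr rfl fun τ _ => ?_
    simp only [Equiv.Perm.decomposeOption_symm_of_none_apply,
      Equiv.Perm.decomposeOption_symm_sign, Option.map_none, Option.map_some]
    ring
  · intro p _
    refine Finset.sum_eq_zero fun τ _ => ?_
    simp [hv]

/-- The matrix with rows `x (b j)`, `y (b j)` and `v`. -/
def pairedRows {l : ℕ} (x y : ℕ → Option (Fin l ⊕ Fin l) → ℝ) (v : Option (Fin l ⊕ Fin l) → ℝ)
    (b : Fin l → ℕ) : Matrix (Option (Fin l ⊕ Fin l)) (Option (Fin l ⊕ Fin l)) ℝ :=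
  Matrix.of fun i => i.elim v (Sum.elim (fun j => x (b j)) (fun j => y (b j)))

theorem sum_det_pairedRows {l : ℕ} (x y : ℕ → Option (Fin l ⊕ Fin l) → ℝ)
    (v : Option (Fin l ⊕ Fin l) → ℝ) (K : ℕ) :
    ∑ b ∈ Fintype.piFinset (fun _ : Fin l => Finset.range K), (pairedRows x y v b).det =
      borderedPairingSum (fun p q => ∑ b ∈ Finset.range K, x b p * y b q) v := by
  have h : ∀ b, (pairedRows x y v b).det = ∑ τ : Equiv.Perm (Option (Fin l ⊕ Fin l)),
      ((Equiv.Perm.sign τ : ℤ) : ℝ) * (v (τ none) *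
        ∏ j, (x (b j) (τ (some (Sum.inl j))) * y (b j) (τ (some (Sum.inr j))))) := by
    intro b
    rw [← Matrix.det_transpose, Matrix.det_apply']
    refine Finset.sum_congr rfl fun τ _ => ?_
    rw [Fintype.prod_option, Fintype.prod_sum_type, ← Finset.prod_mul_distrib]
    rfl
  simp only [h]
  rw [Finset.sum_comm, borderedPairingSum]
  refine Finset.sum_congr rfl fun τ _ => ?_
  rw [← Finset.mul_sum, ← Finset.mul_sum, Finset.prod_univ_sum]

theorem det_pairedRows_comp_perm {l : ℕ} (x y : ℕ → Option (Fin l ⊕ Fin l) → ℝ)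
    (v : Option (Fin l ⊕ Fin l) → ℝ) (b : Fin l → ℕ) (σ : Equiv.Perm (Fin l)) :
    (pairedRows x y v (b ∘ σ)).det = (pairedRows x y v b).det := by
  have h : pairedRows x y v (b ∘ σ) =
      (pairedRows x y v b).submatrix (Equiv.optionCongr (Equiv.Perm.sumCongr σ σ)) id := by
    ext i p
    rcases i with _ | i | i <;> rfl
  rw [h, Matrix.det_permute, Equiv.optionCongr_sign, Equiv.Perm.sign_sumCongr, Int.units_mul_self]
  simp

theorem det_pairedRows_of_not_injective {l : ℕ} (x y : ℕ → Option (Fin l ⊕ Fin l) → ℝ)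
    (v : Option (Fin l ⊕ Fin l) → ℝ) {b : Fin l → ℕ} (hb : ¬ Function.Injective b) :
    (pairedRows x y v b).det = 0 := by
  rw [Function.not_injective_iff] at hb
  obtain ⟨i, j, hij, hne⟩ := hb
  refine Matrix.det_zero_of_row_eq (i := some (Sum.inl i)) (j := some (Sum.inl j)) (by simpa) ?_
  funext p
  simp [pairedRows, hij]

theorem factorial_mul_sum_det_pairedRows {l : ℕ} (x y : ℕ → Option (Fin l ⊕ Fin l) → ℝ)
    (v : Option (Fin l ⊕ Fin l) → ℝ) (K : ℕ) :
    l.factorial * ∑ b ∈ strictSeqs l K, (pairedRows x y v b).det =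
      borderedPairingSum (fun p q => ∑ b ∈ Finset.range K, x b p * y b q) v := by
  rw [← sum_det_pairedRows, sum_piFinset_eq_factorial_mul]
  · exact det_pairedRows_comp_perm x y v
  · exact fun b hb => det_pairedRows_of_not_injective x y v hb

/-- The position of the row `i` of `pairedRows` in `tailMatrix`. -/
def rowPosition {l : ℕ} : Option (Fin l ⊕ Fin l) → Fin (2 * l + 1) := fun i =>
  i.elim ⟨2 * l, by omega⟩
    (Sum.elim (fun j => ⟨2 * j, by omega⟩) (fun j => ⟨2 * j + 1, by omega⟩))

theorem rowPosition_bijective {l : ℕ} : Function.Bijective (rowPosition (l := l)) := by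
  rw [Fintype.bijective_iff_injective_and_card]
  constructor
  · rintro (_ | i | i) (_ | j | j) h <;>
    simp only [rowPosition, Option.elim, Sum.elim_inl, Sum.elim_inr, Fin.mk.injEq] at h
    · rfl
    · omega
    · omega
    · omega
    · congr; omega
    · omega
    · omega
    · omega
    · congr; omega
  · simp; ring

/-- The combination of the values of `g` given by the coefficients of
`(z - β) z ^ l (z ^ k ± z ^ (-k - 1))`, or of `1`. -/
def exponentComb (β : ℝ) {l : ℕ} (p : Option (Fin l ⊕ Fin l)) (g : ℤ → ℝ) : ℝ :=
  p.elim (g 0) (Sum.elim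
    (fun k => g (l + k + 1) + g (l - k) - β * g (l + k) - β * g (l - k - 1))
    (fun k => g (l + k + 1) - g (l - k) - β * g (l + k) + β * g (l - k - 1)))

/-- The matrix of `exponentComb`. -/
def combMatrix (β : ℝ) (l : ℕ) : Matrix (Fin (2 * l + 1)) (Option (Fin l ⊕ Fin l)) ℝ :=
  Matrix.of fun i p => exponentComb β p fun r => if r = 2 * l - i then 1 else 0

theorem sum_mul_combMatrix (β : ℝ) {l : ℕ} (g : ℤ → ℝ) (p : Option (Fin l ⊕ Fin l)) :
    ∑ i : Fin (2 * l + 1), g (2 * l - i) * combMatrix β l i p = exponentComb β p g := by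
  have key : ∀ r : ℤ, 0 ≤ r → r ≤ 2 * l →
      ∑ i : Fin (2 * l + 1), g (2 * l - i) * (if r = 2 * l - i then 1 else 0) = g r := by
    intro r h0 h1
    rw [Finset.sum_eq_single (⟨(2 * l - r).toNat, by omega⟩ : Fin (2 * l + 1))]
    · have : (2 * l - ((2 * l - r).toNat : ℕ) : ℤ) = r := by omega
      simp only [this, if_true, mul_one]
    · intro i _ hi
      rw [if_neg, mul_zero]
      intro h
      apply hi
      ext
      simp only
      omega
    · simp
  rcases p with _ | k | k
  · simp only [combMatrix, Matrix.of_apply, exponentComb, Option.elim]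
    exact key 0 le_rfl (by omega)
  all_goals
    have hk := k.2
    simp only [combMatrix, Matrix.of_apply, exponentComb, Option.elim, Sum.elim_inl, Sum.elim_inr]
    rw [← key (l + k + 1) (by omega) (by omega), ← key (l - k) (by omega) (by omega),
      ← key (l + k) (by omega) (by omega), ← key (l - k - 1) (by omega) (by omega),
      Finset.mul_sum, Finset.mul_sum]
  · rw [← Finset.sum_add_distrib, ← Finset.sum_sub_distrib, ← Finset.sum_sub_distrib]
    exact Finset.sum_congr rfl fun i _ => by ring
  · rw [← Finset.sum_sub_distrib, ← Finset.sum_sub_distrib, ← Finset.sum_add_distrib]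
    exact Finset.sum_congr rfl fun i _ => by ring

theorem det_tailMatrix_mul (β : ℝ) (m : ℤ → ℝ) {l K : ℕ} (b : Fin l → ℕ) :
    (tailMatrix β m K b).det * ((combMatrix β l).submatrix rowPosition id).det =
      (pairedRows (fun b p => exponentComb β p (tailSum β m K (b + 1)))
        (fun b p => exponentComb β p fun r => m (b - r))
        (fun p => exponentComb β p (tailSum β m K 0)) b).det := by
  let e : Option (Fin l ⊕ Fin l) ≃ Fin (2 * l + 1) := Equiv.ofBijective _ rowPosition_bijective
  rw [← Matrix.det_submatrix_equiv_self e, ← Matrix.det_mul,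
    show (combMatrix β l).submatrix rowPosition id = (combMatrix β l).submatrix e id from rfl,
    Matrix.submatrix_mul_equiv]
  congr 1
  ext i p
  rw [Matrix.submatrix_apply, Matrix.mul_apply]
  rcases i with _ | j | j
  · simp only [pairedRows, Matrix.of_apply, Option.elim, id]
    rw [← sum_mul_combMatrix]
    refine Finset.sum_congr rfl fun k _ => ?_
    congr 1
    have : ¬ ((2 * l) / 2 < l) := by omega
    simp [tailMatrix, e, rowPosition, lowerEnd]
  · simp only [pairedRows, Matrix.of_apply, Option.elim, id, Sum.elim_inl]
    rw [← sum_mul_combMatrix]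
    refine Finset.sum_congr rfl fun k _ => ?_
    congr 1
    simp [tailMatrix, e, rowPosition, lowerEnd, extZero_val]
  · simp only [pairedRows, Matrix.of_apply, Option.elim, id, Sum.elim_inr]
    rw [← sum_mul_combMatrix (g := fun r => m (b j - r))]
    refine Finset.sum_congr rfl fun k _ => ?_
    congr 1
    have : (2 * (j : ℕ) + 1) / 2 = j := by omega
    simp [tailMatrix, e, rowPosition, this, extZero_val]

theorem factorial_mul_sum_strictSeqs (β : ℝ) (m : ℤ → ℝ) {l : ℕ} (hl : 0 < l) (K : ℕ) :
    l.factorial * ((∑ a ∈ strictSeqs (2 * l + 1) K, seqWeight β a * (rowMatrix m a).det) *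
      ((combMatrix β l).submatrix rowPosition id).det) =
      borderedPairingSum (l := l) (fun p q => ∑ b ∈ Finset.range K,
          exponentComb β p (tailSum β m K (b + 1)) * exponentComb β q fun r => m (b - r))
        (fun p => exponentComb β p (tailSum β m K 0)) := by
  rw [sum_strictSeqs_eq β m hl, ← factorial_mul_sum_det_pairedRows, Finset.sum_mul]
  simp only [det_tailMatrix_mul]

open Filter Topology in
theorem tendsto_exponentComb {β : ℝ} {l : ℕ} (p : Option (Fin l ⊕ Fin l)) {g : ℕ → ℤ → ℝ}
    {h : ℤ → ℝ} (hg : ∀ r, Tendsto (fun K => g K r) atTop (𝓝 (h r))) :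
    Tendsto (fun K => exponentComb β p (g K)) atTop (𝓝 (exponentComb β p h)) := by
  rcases p with _ | k | k
  · exact hg 0
  · exact (((hg _).add (hg _)).sub ((hg _).const_mul β)).sub ((hg _).const_mul β)
  · exact (((hg _).sub (hg _)).sub ((hg _).const_mul β)).add ((hg _).const_mul β)

theorem exists_abs_exponentComb_le {β s : ℝ} (hβ : 0 < β) {l : ℕ}
    (p : Option (Fin l ⊕ Fin l)) :
    ∃ M : ℝ, ∀ (g : ℤ → ℝ) (A : ℝ), (∀ r, |g r| ≤ A * s ^ (-r)) →
      |exponentComb β p g| ≤ A * M := by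
  have hsub : ∀ {a b x y : ℝ}, |a| ≤ x → |b| ≤ y → |a - b| ≤ x + y := fun h1 h2 =>
    (abs_sub _ _).trans (add_le_add h1 h2)
  have hadd : ∀ {a b x y : ℝ}, |a| ≤ x → |b| ≤ y → |a + b| ≤ x + y := fun h1 h2 =>
    (abs_add_le _ _).trans (add_le_add h1 h2)
  have hmul : ∀ {a x : ℝ}, |a| ≤ x → |β * a| ≤ β * x := fun h1 => by
    rw [abs_mul, abs_of_pos hβ]
    exact mul_le_mul_of_nonneg_left h1 hβ.le
  rcases p with _ | k | k
  · refine ⟨s ^ (-(0 : ℤ)), fun g A h => h 0⟩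
  all_goals
    refine ⟨s ^ (-((l : ℤ) + k + 1)) + s ^ (-((l : ℤ) - k)) + β * s ^ (-((l : ℤ) + k)) +
      β * s ^ (-((l : ℤ) - k - 1)), fun g A h => ?_⟩
  · exact (hsub (hsub (hadd (h _) (h _)) (hmul (h _))) (hmul (h _))).trans (le_of_eq (by ring))
  · exact (hadd (hsub (hsub (h _) (h _)) (hmul (h _))) (hmul (h _))).trans (le_of_eq (by ring))

/-- A sequence supported on the nonnegative integers with geometric decay of ratio `s`,
where `s < 1` and `β s < 1`. -/
structure GeomDecay (β : ℝ) (m : ℤ → ℝ) (D s : ℝ) : Prop where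
  beta_pos : 0 < β
  ratio_pos : 0 < s
  ratio_lt_one : s < 1
  beta_mul_lt_one : β * s < 1
  eq_zero_of_neg : ∀ k < 0, m k = 0
  abs_le : ∀ k, |m k| ≤ D * s ^ k

/-- The infinite weighted tail `∑_{x ≥ a} β^(x - a) m(x - r)`. -/
def tailLimit (β : ℝ) (m : ℤ → ℝ) (a : ℕ) (r : ℤ) : ℝ := ∑' d : ℕ, β ^ d * m (a + d - r)

namespace GeomDecay

variable {β : ℝ} {m : ℤ → ℝ} {D s : ℝ}

theorem const_nonneg (h : GeomDecay β m D s) : 0 ≤ D := by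
  have := (abs_nonneg _).trans (h.abs_le 0)
  simpa using this

theorem abs_tail_term_le (h : GeomDecay β m D s) (a : ℕ) (r : ℤ) (d : ℕ) :
    |β ^ d * m (a + d - r)| ≤ D * s ^ a * s ^ (-r) * (β * s) ^ d := by
  have hs := h.ratio_pos
  rw [abs_mul, abs_of_pos (pow_pos h.beta_pos d)]
  refine (mul_le_mul_of_nonneg_left (h.abs_le _) (pow_pos h.beta_pos d).le).trans (le_of_eq ?_)
  rw [show (a + d - r : ℤ) = a + d + -r by ring, zpow_add₀ hs.ne', zpow_add₀ hs.ne', mul_pow,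
    zpow_natCast, zpow_natCast]
  ring

theorem summable_geometric (h : GeomDecay β m D s) : Summable fun d : ℕ => (β * s) ^ d :=
  summable_geometric_of_lt_one (mul_pos h.beta_pos h.ratio_pos).le h.beta_mul_lt_one

theorem summable_tail (h : GeomDecay β m D s) (a : ℕ) (r : ℤ) :
    Summable fun d : ℕ => β ^ d * m (a + d - r) :=
  Summable.of_norm_bounded (h.summable_geometric.mul_left _) (h.abs_tail_term_le a r)

theorem tailSum_eq_sum_range (β : ℝ) (m : ℤ → ℝ) (K a : ℕ) (r : ℤ) :
    tailSum β m K a r = ∑ d ∈ Finset.range (K - a), β ^ d * m (a + d - r) := by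
  rw [tailSum, Finset.sum_Ico_eq_sum_range]
  refine Finset.sum_congr rfl fun d _ => ?_
  rw [Nat.add_sub_cancel_left]
  push_cast
  rfl

open Filter Topology in
theorem tendsto_tailSum (h : GeomDecay β m D s) (a : ℕ) (r : ℤ) :
    Tendsto (fun K => tailSum β m K a r) atTop (𝓝 (tailLimit β m a r)) := by
  simp only [tailSum_eq_sum_range]
  exact (h.summable_tail a r).hasSum.tendsto_sum_nat.comp (tendsto_sub_atTop_nat a)

theorem abs_tailSum_le (h : GeomDecay β m D s) (K a : ℕ) (r : ℤ) :
    |tailSum β m K a r| ≤ D * s ^ a * (1 - β * s)⁻¹ * s ^ (-r) := by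
  rw [tailSum_eq_sum_range]
  refine (Finset.abs_sum_le_sum_abs _ _).trans ?_
  refine (Finset.sum_le_sum fun d _ => h.abs_tail_term_le a r d).trans ?_
  rw [← Finset.mul_sum]
  have hbs := (mul_pos h.beta_pos h.ratio_pos).le
  have h1 : ∑ d ∈ Finset.range (K - a), (β * s) ^ d ≤ (1 - β * s)⁻¹ := by
    rw [← tsum_geometric_of_lt_one hbs h.beta_mul_lt_one]
    exact h.summable_geometric.sum_le_tsum _ fun d _ => pow_nonneg hbs d
  have h2 : 0 ≤ D * s ^ a * s ^ (-r) :=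
    mul_nonneg (mul_nonneg h.const_nonneg (pow_nonneg h.ratio_pos.le _))
      (zpow_nonneg h.ratio_pos.le _)
  exact (mul_le_mul_of_nonneg_left h1 h2).trans (le_of_eq (by ring))

theorem tailLimit_succ (h : GeomDecay β m D s) (a : ℕ) (r : ℤ) :
    tailLimit β m a (r + 1) = m (a - r - 1) + β * tailLimit β m a r := by
  rw [tailLimit, (h.summable_tail a (r + 1)).tsum_eq_zero_add, tailLimit, ← tsum_mul_left]
  congr 1
  · simp [sub_sub]
  · refine tsum_congr fun d => ?_
    rw [pow_succ']
    push_cast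
    rw [mul_assoc]
    congr 3
    ring

end GeomDecay

/-- The combination of shifts of `m` attached to `z ^ l (z ^ k ± z ^ (-k - 1))`. -/
def shiftComb (m : ℤ → ℝ) {l : ℕ} (p : Fin l ⊕ Fin l) (b : ℤ) : ℝ :=
  Sum.elim (fun k : Fin l => m (b - l - k) + m (b - l + k + 1))
    (fun k : Fin l => m (b - l - k) - m (b - l + k + 1)) p

theorem exponentComb_sub (β : ℝ) (m : ℤ → ℝ) {l : ℕ} (p : Fin l ⊕ Fin l) (b : ℤ) :
    exponentComb β (some p) (fun r => m (b - r)) =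
      shiftComb m p (b - 1) - β * shiftComb m p b := by
  have e1 : ∀ k : ℤ, b - (l + k + 1) = b - 1 - l - k := fun k => by ring
  have e2 : ∀ k : ℤ, b - (l - k) = b - 1 - l + k + 1 := fun k => by ring
  have e3 : ∀ k : ℤ, b - (l + k) = b - l - k := fun k => by ring
  have e4 : ∀ k : ℤ, b - (l - k - 1) = b - l + k + 1 := fun k => by ring
  rcases p with k | k <;>
  · simp only [exponentComb, shiftComb, Option.elim, Sum.elim_inl, Sum.elim_inr, e1, e2, e3, e4]
    ring

namespace GeomDecay

variable {β : ℝ} {m : ℤ → ℝ} {D s : ℝ}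

theorem exponentComb_tailLimit (h : GeomDecay β m D s) {l : ℕ} (p : Fin l ⊕ Fin l) (a : ℕ) :
    exponentComb β (some p) (tailLimit β m a) = shiftComb m p (a - 1) := by
  have e1 : ∀ k : ℤ, (l : ℤ) - k = l - k - 1 + 1 := fun k => by ring
  rcases p with k | k
  all_goals
    simp only [exponentComb, shiftComb, Option.elim, Sum.elim_inl, Sum.elim_inr]
    rw [e1 k, h.tailLimit_succ, h.tailLimit_succ,
      show (a : ℤ) - (l + k) - 1 = a - 1 - l - k by ring,
      show (a : ℤ) - (l - k - 1) - 1 = a - 1 - l + k + 1 by ring]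
    ring_nf

theorem exponentComb_tailLimit_zero (h : GeomDecay β m D s) {l : ℕ} (p : Fin l ⊕ Fin l) :
    exponentComb β (some p) (tailLimit β m 0) = 0 := by
  rw [h.exponentComb_tailLimit]
  rcases p with k | k
  all_goals
    have := k.2
    simp only [shiftComb, Sum.elim_inl, Sum.elim_inr]
    rw [h.eq_zero_of_neg _ (by omega), h.eq_zero_of_neg _ (by omega)]
    simp

open Filter Topology in
theorem tendsto_sum_exponentComb (h : GeomDecay β m D s) {l : ℕ} (p q : Option (Fin l ⊕ Fin l)) :
    Tendsto (fun K => ∑ b ∈ Finset.range K, exponentComb β p (tailSum β m K (b + 1)) *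
      exponentComb β q fun r => m (b - r)) atTop
      (𝓝 (∑' b : ℕ, exponentComb β p (tailLimit β m (b + 1)) *
        exponentComb β q fun r => m (b - r))) := by
  obtain ⟨M, hM⟩ := exists_abs_exponentComb_le (s := s) h.beta_pos p
  obtain ⟨M', hM'⟩ := exists_abs_exponentComb_le (s := s) h.beta_pos q
  have hs := h.ratio_pos
  have h1 : ∀ K b : ℕ, |exponentComb β p (tailSum β m K (b + 1))| ≤
      D * s ^ (b + 1) * (1 - β * s)⁻¹ * M := fun K b =>
    hM _ _ fun r => h.abs_tailSum_le K (b + 1) r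
  have h2 : ∀ b : ℕ, |exponentComb β q fun r => m (b - r)| ≤ D * s ^ b * M' := fun b => by
    refine hM' _ _ fun r => (h.abs_le _).trans (le_of_eq ?_)
    rw [sub_eq_add_neg, zpow_add₀ hs.ne', zpow_natCast, mul_assoc]
  have h3 : ∀ K b : ℕ, |exponentComb β p (tailSum β m K (b + 1)) *
      exponentComb β q fun r => m (b - r)| ≤
      (D * s * (1 - β * s)⁻¹ * M * (D * M')) * (s * s) ^ b := fun K b => by
    rw [abs_mul]
    refine (mul_le_mul (h1 K b) (h2 b) (abs_nonneg _) ((abs_nonneg _).trans (h1 K b))).trans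
      (le_of_eq ?_)
    rw [pow_succ, mul_pow]
    ring
  have hsum : Summable fun b : ℕ => (D * s * (1 - β * s)⁻¹ * M * (D * M')) * (s * s) ^ b := by
    refine (summable_geometric_of_lt_one (mul_pos hs hs).le ?_).mul_left _
    nlinarith [h.ratio_lt_one]
  have key := tendsto_tsum_of_dominated_convergence (𝓕 := atTop)
    (f := fun K b : ℕ => if b < K then exponentComb β p (tailSum β m K (b + 1)) *
      exponentComb β q (fun r => m (b - r)) else 0)
    (g := fun b : ℕ => exponentComb β p (tailLimit β m (b + 1)) *
        exponentComb β q fun r => m (b - r)) hsum ?_ ?_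
  · refine key.congr fun K => ?_
    rw [tsum_eq_sum (s := Finset.range K)]
    · exact Finset.sum_congr rfl fun b hb => if_pos (Finset.mem_range.1 hb)
    · intro b hb
      exact if_neg fun hlt => hb (Finset.mem_range.2 hlt)
  · intro b
    refine Tendsto.congr' (f₁ := fun K => exponentComb β p (tailSum β m K (b + 1)) *
      exponentComb β q (fun r => m (b - r))) ?_ ?_
    · filter_upwards [eventually_gt_atTop b] with K hK
      exact (if_pos hK).symm
    · exact (tendsto_exponentComb p fun r => h.tendsto_tailSum (b + 1) r).mul_const _
  · refine Eventually.of_forall fun K b => ?_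
    rw [Real.norm_eq_abs]
    split_ifs
    · exact h3 K b
    · rw [abs_zero]
      exact (abs_nonneg _).trans (h3 K b)

theorem abs_le_const (h : GeomDecay β m D s) (k : ℤ) : |m k| ≤ D := by
  rcases lt_or_ge k 0 with hk | hk
  · rw [h.eq_zero_of_neg k hk, abs_zero]
    exact h.const_nonneg
  · lift k to ℕ using hk
    refine (h.abs_le _).trans (mul_le_of_le_one_right h.const_nonneg ?_)
    rw [zpow_natCast]
    exact pow_le_one₀ h.ratio_pos.le h.ratio_lt_one.le

theorem summable (h : GeomDecay β m D s) : Summable m := by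
  rw [← Function.Injective.summable_iff Nat.cast_injective (f := m)]
  · refine Summable.of_norm_bounded
      ((summable_geometric_of_lt_one h.ratio_pos.le h.ratio_lt_one).mul_left D) fun k => ?_
    simpa using h.abs_le k
  · intro k hk
    apply h.eq_zero_of_neg
    by_contra hc
    exact hk ⟨k.toNat, by simp; omega⟩

theorem summable_shift_mul_shift (h : GeomDecay β m D s) (a a' : ℤ) :
    Summable fun b : ℤ => m (b - a) * m (b - a') := by
  have h1 : Summable fun b : ℤ => |m (b - a)| :=
    (Equiv.subRight a).summable_iff.2 h.summable.abs
  refine Summable.of_norm_bounded (h1.mul_right D) fun b => ?_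
  rw [Real.norm_eq_abs, abs_mul]
  exact mul_le_mul_of_nonneg_left (h.abs_le_const _) (abs_nonneg _)

end GeomDecay

/-- The autocorrelation of the sequence `m`. -/
def autocorr (m : ℤ → ℝ) (d : ℤ) : ℝ := ∑' k : ℤ, m k * m (k + d)

theorem autocorr_neg (m : ℤ → ℝ) (d : ℤ) : autocorr m (-d) = autocorr m d := by
  rw [autocorr, ← (Equiv.addRight d).tsum_eq, autocorr]
  refine tsum_congr fun k => ?_
  simp [mul_comm]

theorem tsum_shift_mul_shift (m : ℤ → ℝ) (a a' : ℤ) :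
    ∑' b : ℤ, m (b - a) * m (b - a') = autocorr m (a - a') := by
  rw [← (Equiv.addRight a).tsum_eq, autocorr]
  refine tsum_congr fun k => ?_
  simp [add_sub_assoc]

/-- The sign of the second term of `shiftComb`. -/
def shiftSign {l : ℕ} (p : Fin l ⊕ Fin l) : ℝ := Sum.elim (fun _ => 1) (fun _ => -1) p

/-- The index of an element of `Fin l ⊕ Fin l`. -/
def shiftIndex {l : ℕ} (p : Fin l ⊕ Fin l) : ℤ :=
  Sum.elim (fun k : Fin l => (k : ℤ)) (fun k : Fin l => (k : ℤ)) p

theorem shiftComb_eq (m : ℤ → ℝ) {l : ℕ} (p : Fin l ⊕ Fin l) (b : ℤ) :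
    shiftComb m p b =
      m (b - (l + shiftIndex p)) + shiftSign p * m (b - (l - shiftIndex p - 1)) := by
  rcases p with k | k <;>
  · simp only [shiftComb, shiftSign, shiftIndex, Sum.elim_inl, Sum.elim_inr]
    ring_nf

namespace GeomDecay

variable {β : ℝ} {m : ℤ → ℝ} {D s : ℝ}

theorem hasSum_shift_mul_shift (h : GeomDecay β m D s) (a a' : ℤ) :
    HasSum (fun b : ℤ => m (b - a) * m (b - a')) (autocorr m (a - a')) := by
  rw [← tsum_shift_mul_shift]
  exact (h.summable_shift_mul_shift a a').hasSum

theorem shiftComb_of_neg (h : GeomDecay β m D s) {l : ℕ} (p : Fin l ⊕ Fin l) {b : ℤ}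
    (hb : b < 0) : shiftComb m p b = 0 := by
  rcases p with k | k
  all_goals
    have := k.2
    simp only [shiftComb, Sum.elim_inl, Sum.elim_inr]
    rw [h.eq_zero_of_neg _ (by omega), h.eq_zero_of_neg _ (by omega)]
    simp

/-- The value of `∑_b shiftComb p b * shiftComb q (b - e)`. -/
theorem hasSum_shiftComb_mul (h : GeomDecay β m D s) {l : ℕ} (p q : Fin l ⊕ Fin l) (e : ℤ) :
    HasSum (fun b : ℕ => shiftComb m p b * shiftComb m q (b - e))
      (autocorr m (shiftIndex p - shiftIndex q - e) +
        shiftSign q * autocorr m (shiftIndex p + shiftIndex q + 1 - e) +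
        shiftSign p * autocorr m (-shiftIndex p - shiftIndex q - 1 - e) +
        shiftSign p * shiftSign q * autocorr m (-shiftIndex p + shiftIndex q - e)) := by
  have key : HasSum (fun b : ℤ => shiftComb m p b * shiftComb m q (b - e))
      (autocorr m (shiftIndex p - shiftIndex q - e) +
        shiftSign q * autocorr m (shiftIndex p + shiftIndex q + 1 - e) +
        shiftSign p * autocorr m (-shiftIndex p - shiftIndex q - 1 - e) +
        shiftSign p * shiftSign q * autocorr m (-shiftIndex p + shiftIndex q - e)) := by
    have := (((h.hasSum_shift_mul_shift (l + shiftIndex p) (l + shiftIndex q + e)).add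
      ((h.hasSum_shift_mul_shift (l + shiftIndex p) (l - shiftIndex q - 1 + e)).mul_left
        (shiftSign q))).add
      ((h.hasSum_shift_mul_shift (l - shiftIndex p - 1) (l + shiftIndex q + e)).mul_left
        (shiftSign p))).add
      ((h.hasSum_shift_mul_shift (l - shiftIndex p - 1) (l - shiftIndex q - 1 + e)).mul_left
        (shiftSign p * shiftSign q))
    rw [show l + shiftIndex p - (l + shiftIndex q + e) = shiftIndex p - shiftIndex q - e by ring,
      show l + shiftIndex p - (l - shiftIndex q - 1 + e) =
        shiftIndex p + shiftIndex q + 1 - e by ring,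
      show l - shiftIndex p - 1 - (l + shiftIndex q + e) =
        -shiftIndex p - shiftIndex q - 1 - e by ring,
      show l - shiftIndex p - 1 - (l - shiftIndex q - 1 + e) =
        -shiftIndex p + shiftIndex q - e by ring] at this
    convert this using 1
    · funext b
      rw [shiftComb_eq, shiftComb_eq]
      rw [show b - e - (l + shiftIndex q) = b - (l + shiftIndex q + e) by ring,
        show b - e - (l - shiftIndex q - 1) = b - (l - shiftIndex q - 1 + e) by ring]
      ring
  refine (Function.Injective.hasSum_iff (g := ((↑) : ℕ → ℤ)) Nat.cast_injective ?_).2 key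
  intro b hb
  rw [h.shiftComb_of_neg p, zero_mul]
  by_contra hc
  exact hb ⟨b.toNat, by simp; omega⟩

end GeomDecay

/-- The Toeplitz-minus-Hankel matrix of the autocorrelation of `m`. -/
def autocorrMatrix (m : ℤ → ℝ) (l : ℕ) : Matrix (Fin l) (Fin l) ℝ :=
  Matrix.of fun j k => autocorr m (j - k) - autocorr m (j + k + 2)

theorem sum_ite_succ_eq_mul {l : ℕ} (i : Fin l) (a : ℝ) {f : ℤ → ℝ} (hf : f (-1) = 0) :
    ∑ k : Fin l, (if (k : ℕ) + 1 = i then a else 0) * f k = a * f (i - 1) := by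
  by_cases hi : (i : ℕ) = 0
  · rw [hi, Nat.cast_zero, zero_sub, hf, mul_zero]
    exact Finset.sum_eq_zero fun k _ => by rw [if_neg (by omega), zero_mul]
  · have := i.2
    rw [Finset.sum_eq_single (⟨i - 1, by omega⟩ : Fin l)]
    · rw [if_pos (by simp only; omega)]
      congr 2
      simp only
      omega
    · intro k _ hk
      have : (k : ℕ) ≠ i - 1 := fun h => hk (Fin.ext h)
      rw [if_neg (by omega), zero_mul]
    · simp

theorem det_skew_eq (m : ℤ → ℝ) (l : ℕ) :
    (Matrix.of fun i j : Fin l => 2 * (autocorr m (i - j - 1) - autocorr m (i + j) +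
      autocorr m (i + j + 2) - autocorr m (i - j + 1))).det =
      (-2) ^ l * (autocorrMatrix m l).det := by
  let P : ℝ → Matrix (Fin l) (Fin l) ℝ := fun a =>
    Matrix.of fun i k => if (k : ℕ) + 1 = i then a else 0
  have hP : ∀ (a : ℝ) (A : Matrix (Fin l) (Fin l) ℝ), ((1 + P a) * A).det = A.det := by
    intro a A
    apply det_one_add_mul_of_lower
    intro i k hik
    have : (i : ℕ) ≤ k := hik
    simp only [P, Matrix.of_apply]
    rw [if_neg (by omega)]
  have h1 : ((1 + P (-1)) * ((1 + P 1) * (autocorrMatrix m l).transpose).transpose).det =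
      (autocorrMatrix m l).det := by
    rw [hP, Matrix.det_transpose, hP, Matrix.det_transpose]
  have h2 := Matrix.det_smul
    ((1 + P (-1)) * ((1 + P 1) * (autocorrMatrix m l).transpose).transpose) (-2 : ℝ)
  rw [Fintype.card_fin, h1] at h2
  rw [← h2]
  congr 1
  have e1 : ∀ i j : Fin l, ((1 + P 1) * (autocorrMatrix m l).transpose).transpose i j =
      autocorr m (i - j) - autocorr m (i + j + 2) +
        (autocorr m (i - j + 1) - autocorr m (i + j + 1)) := by
    intro i j
    rw [Matrix.transpose_apply, Matrix.add_mul, Matrix.one_mul, Matrix.add_apply,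
      Matrix.mul_apply]
    have := sum_ite_succ_eq_mul j 1
      (f := fun k => autocorr m (i - k) - autocorr m (i + k + 2)) (by ring_nf)
    simp only [P, Matrix.of_apply, Matrix.transpose_apply, autocorrMatrix]
    rw [this]
    ring_nf
  ext i j
  rw [Matrix.smul_apply, Matrix.add_mul, Matrix.one_mul, Matrix.add_apply, Matrix.mul_apply]
  have := sum_ite_succ_eq_mul i (-1)
      (f := fun k => autocorr m (k - j) - autocorr m (k + j + 2) +
        (autocorr m (k - j + 1) - autocorr m (k + j + 1))) (by
      rw [← autocorr_neg m (-1 - j), ← autocorr_neg m (-1 - j + 1)]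
      ring_nf)
  simp only [e1]
  simp only [P, Matrix.of_apply]
  rw [this, smul_eq_mul]
  ring_nf

namespace GeomDecay

variable {β : ℝ} {m : ℤ → ℝ} {D s : ℝ}

theorem tsum_exponentComb_mul (h : GeomDecay β m D s) {l : ℕ} (p q : Fin l ⊕ Fin l) :
    (∑' b : ℕ, exponentComb β (some p) (tailLimit β m (b + 1)) *
        exponentComb β (some q) fun r => m (b - r)) =
      (autocorr m (shiftIndex p - shiftIndex q - 1) +
        shiftSign q * autocorr m (shiftIndex p + shiftIndex q + 1 - 1) +
        shiftSign p * autocorr m (-shiftIndex p - shiftIndex q - 1 - 1) +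
        shiftSign p * shiftSign q * autocorr m (-shiftIndex p + shiftIndex q - 1)) -
      β * (autocorr m (shiftIndex p - shiftIndex q - 0) +
        shiftSign q * autocorr m (shiftIndex p + shiftIndex q + 1 - 0) +
        shiftSign p * autocorr m (-shiftIndex p - shiftIndex q - 1 - 0) +
        shiftSign p * shiftSign q * autocorr m (-shiftIndex p + shiftIndex q - 0)) := by
  rw [← ((h.hasSum_shiftComb_mul p q 1).sub
    ((h.hasSum_shiftComb_mul p q 0).mul_left β)).tsum_eq]
  refine tsum_congr fun b => ?_
  rw [h.exponentComb_tailLimit, exponentComb_sub]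
  push_cast
  rw [add_sub_cancel_right, sub_zero]
  ring

theorem pairingSum_eq (h : GeomDecay β m D s) (l : ℕ) :
    pairingSum (fun _ (p q : Fin l ⊕ Fin l) =>
      ∑' b : ℕ, exponentComb β (some p) (tailLimit β m (b + 1)) *
        exponentComb β (some q) fun r => m (b - r)) =
      l.factorial * ((-2) ^ l * (autocorrMatrix m l).det) := by
  simp only [h.tsum_exponentComb_mul]
  rw [pairingSum_eq_factorial_mul_det, ← det_skew_eq]
  · congr 3
    ext i j
    simp only [shiftIndex, shiftSign, Sum.elim_inl, Sum.elim_inr]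
    have f1 : autocorr m (-(i : ℤ) - j - 1 - 1) = autocorr m (i + j + 2) := by
      rw [← autocorr_neg]; ring_nf
    have f2 : autocorr m (-(i : ℤ) + j - 1) = autocorr m (i - j + 1) := by
      rw [← autocorr_neg]; ring_nf
    have f3 : autocorr m (-(i : ℤ) - j - 1 - 0) = autocorr m (i + j + 1) := by
      rw [← autocorr_neg]; ring_nf
    have f4 : autocorr m (-(i : ℤ) + j - 0) = autocorr m (i - j) := by
      rw [← autocorr_neg]; ring_nf
    have g1 : autocorr m (-(j : ℤ) - i - 1 - 1) = autocorr m (i + j + 2) := by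
      rw [← autocorr_neg]; ring_nf
    have g2 : autocorr m ((j : ℤ) - i - 1) = autocorr m (i - j + 1) := by
      rw [← autocorr_neg]; ring_nf
    have g3 : autocorr m (-(j : ℤ) - i - 1 - 0) = autocorr m (i + j + 1) := by
      rw [← autocorr_neg]; ring_nf
    have g4 : autocorr m ((j : ℤ) - i - 0) = autocorr m (i - j) := by
      rw [← autocorr_neg]; ring_nf
    rw [f1, f2, f3, f4, g1, g2, g3, g4]
    ring_nf
  all_goals
    intro i j
    simp only [shiftIndex, shiftSign, Sum.elim_inl, Sum.elim_inr]
    ring_nf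

open Filter Topology in
theorem tendsto_sum_strictSeqs_mul (h : GeomDecay β m D s) {l : ℕ} (hl : 0 < l) :
    Tendsto (fun K => (∑ a ∈ strictSeqs (2 * l + 1) K, seqWeight β a * (rowMatrix m a).det) *
      ((combMatrix β l).submatrix rowPosition id).det) atTop
      (𝓝 (tailLimit β m 0 0 * ((-2) ^ l * (autocorrMatrix m l).det))) := by
  have hf : (l.factorial : ℝ) ≠ 0 := Nat.cast_ne_zero.2 l.factorial_ne_zero
  have h1 : Tendsto (fun K => borderedPairingSum (l := l) (fun p q => ∑ b ∈ Finset.range K,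
      exponentComb β p (tailSum β m K (b + 1)) * exponentComb β q fun r => m (b - r))
      (fun p => exponentComb β p (tailSum β m K 0))) atTop
      (𝓝 (borderedPairingSum (l := l) (fun p q => ∑' b : ℕ,
        exponentComb β p (tailLimit β m (b + 1)) * exponentComb β q fun r => m (b - r))
        (fun p => exponentComb β p (tailLimit β m 0)))) := by
    unfold borderedPairingSum
    refine tendsto_finsetSum _ fun τ _ => Tendsto.const_mul _ (Tendsto.mul ?_ ?_)
    · exact tendsto_exponentComb _ fun r => h.tendsto_tailSum 0 r
    · exact tendsto_finsetProd _ fun j _ => h.tendsto_sum_exponentComb _ _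
  rw [borderedPairingSum_eq_mul h.exponentComb_tailLimit_zero, h.pairingSum_eq] at h1
  simp only [← factorial_mul_sum_strictSeqs β m hl] at h1
  have h2 := h1.const_mul (l.factorial : ℝ)⁻¹
  simp only [inv_mul_cancel_left₀ hf] at h2
  convert h2 using 2
  rw [show exponentComb β (none : Option (Fin l ⊕ Fin l)) (tailLimit β m 0) =
    tailLimit β m 0 0 from rfl]
  field_simp

end GeomDecay

theorem exists_geomDecay_binomCoeff {t β : ℝ} (ht : 0 < t) (ht1 : t < 1) (hβ : 0 < β)
    (hβt : β * t < 1) (N : ℕ) : ∃ D s, GeomDecay β (binomCoeff N t) D s := by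
  obtain ⟨s, hts, hs⟩ : ∃ s, t < s ∧ s < min 1 β⁻¹ := by
    refine exists_between (lt_min ht1 ?_)
    rwa [← one_div, lt_div_iff₀ hβ, mul_comm]
  rw [lt_min_iff] at hs
  have hs0 : 0 < s := ht.trans hts
  have hsum : Summable fun k : ℕ => ((k + N).choose N : ℝ) * (t / s) ^ k := by
    apply summable_choose_mul_geometric_of_norm_lt_one
    rw [Real.norm_eq_abs, abs_of_pos (div_pos ht hs0)]
    exact (div_lt_one hs0).2 hts
  refine ⟨∑' k : ℕ, ((k + N).choose N : ℝ) * (t / s) ^ k, s, hβ, hs0, hs.1, ?_,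
    fun k hk => binomCoeff_of_neg N t hk, fun k => ?_⟩
  · have := mul_lt_mul_of_pos_left hs.2 hβ
    rwa [mul_inv_cancel₀ hβ.ne'] at this
  · have hnn : ∀ k : ℕ, 0 ≤ ((k + N).choose N : ℝ) * (t / s) ^ k := fun k => by positivity
    rcases lt_or_ge k 0 with hk | hk
    · rw [binomCoeff_of_neg N t hk, abs_zero]
      exact mul_nonneg (tsum_nonneg hnn) (zpow_nonneg hs0.le _)
    · lift k to ℕ using hk
      rw [binomCoeff_natCast, abs_of_nonneg (by positivity), zpow_natCast]
      have h1 : (N.multichoose k : ℝ) ≤ ((k + N).choose N : ℝ) := by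
        rw [Nat.multichoose_eq, ← Nat.choose_symm_add]
        exact_mod_cast Nat.choose_le_choose k (by omega)
      have h2 := hsum.le_tsum k fun j _ => hnn j
      calc (N.multichoose k : ℝ) * t ^ k ≤ ((k + N).choose N : ℝ) * t ^ k :=
            mul_le_mul_of_nonneg_right h1 (by positivity)
        _ = ((k + N).choose N : ℝ) * (t / s) ^ k * s ^ k := by
            rw [div_pow, mul_assoc, div_mul_cancel₀ _ (by positivity)]
        _ ≤ _ := mul_le_mul_of_nonneg_right h2 (by positivity)

/-- The strictly decreasing sequence attached to a partition with at most `n + 1` rows. -/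
def strictSeqOf (n : ℕ) (μ : YoungDiagram) (i : Fin (n + 1)) : ℕ := μ.rowLen i + (n - i)

theorem strictAnti_strictSeqOf (n : ℕ) (μ : YoungDiagram) : StrictAnti (strictSeqOf n μ) := by
  intro i j hij
  have := rowLen_antitone μ (n + 1) hij.le
  have h1 : (i : ℕ) < j := hij
  simp only [strictSeqOf]
  simp only at this
  omega

theorem strictSeqOf_injective (n : ℕ) :
    Function.Injective fun μ : {μ : YoungDiagram // numRows μ ≤ n + 1} => strictSeqOf n μ := by
  rintro ⟨μ, hμ⟩ ⟨ν, hν⟩ h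
  apply Subtype.ext
  simp only
  rw [← diagOf_rowLen hμ, ← diagOf_rowLen hν]
  congr 1
  funext i
  have := congrFun h i
  simp only [strictSeqOf] at this
  omega

theorem exists_strictSeqOf_eq {n : ℕ} {a : Fin (n + 1) → ℕ} (ha : StrictAnti a) :
    ∃ μ : {μ : YoungDiagram // numRows μ ≤ n + 1}, strictSeqOf n μ = a := by
  have hge : ∀ i : Fin (n + 1), n - (i : ℕ) ≤ a i := by
    intro i
    induction i using Fin.reverseInduction with
    | last => simp
    | cast i ih =>
      have := ha (Fin.castSucc_lt_succ (i := i))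
      rw [Fin.val_succ] at ih
      rw [Fin.val_castSucc]
      omega
  have hanti : Antitone fun i : Fin (n + 1) => a i - (n - i) := by
    rw [Fin.antitone_iff_succ_le]
    intro i
    have := ha (Fin.castSucc_lt_succ (i := i))
    rw [Fin.val_succ, Fin.val_castSucc]
    omega
  refine ⟨⟨diagOf _, numRows_diagOf_le hanti⟩, ?_⟩
  funext i
  have := hge i
  simp only [strictSeqOf, rowLen_diagOf hanti, extZero_val]
  omega

theorem prod_range_ite_even (F : ℕ → ℝ) (l : ℕ) :
    ∏ i ∈ Finset.range (2 * l + 1), (if i % 2 = 0 then F i else 1) =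
      ∏ q ∈ Finset.range (l + 1), F (2 * q) := by
  induction l with
  | zero => simp
  | succ l ih =>
    rw [show 2 * (l + 1) + 1 = 2 * l + 1 + 1 + 1 by ring, Finset.prod_range_succ,
      Finset.prod_range_succ, ih, Finset.prod_range_succ _ (l + 1), if_neg (by omega),
      if_pos (by omega), mul_one]
    rfl

theorem seqWeight_strictSeqOf (β : ℝ) {l : ℕ} {μ : YoungDiagram} (hμ : numRows μ ≤ 2 * l + 1) :
    seqWeight β (strictSeqOf (2 * l) μ) = β ^ oddCols μ := by
  rw [oddCols_eq_sum hμ, ← Finset.prod_pow_eq_pow_sum,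
    ← prod_range_ite_even (fun i => β ^ (μ.rowLen i - μ.rowLen (i + 1))),
    ← Fin.prod_univ_eq_prod_range (fun i => if i % 2 = 0 then
      β ^ (μ.rowLen i - μ.rowLen (i + 1)) else 1), seqWeight]
  refine Finset.prod_congr rfl fun i _ => ?_
  have hi2 := i.2
  unfold entryWeight
  split_ifs with hi
  · congr 1
    unfold lowerEnd
    split_ifs with h
    · rw [extZero_oddEntries _ h]
      have e : 2 * ((i : ℕ) / 2) + 1 = i + 1 := by omega
      simp only [strictSeqOf, e]
      omega
    · have e : (i : ℕ) = 2 * l := by omega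
      have e2 : μ.rowLen (2 * l + 1) = 0 := rowLen_eq_zero_of_numRows_le hμ le_rfl
      simp [strictSeqOf, e, e2]
  · rfl

theorem det_rowMatrix_strictSeqOf (N : ℕ) (t : ℝ) {l : ℕ} {μ : YoungDiagram}
    (hμ : numRows μ ≤ 2 * l + 1) :
    (rowMatrix (binomCoeff N t) (strictSeqOf (2 * l) μ)).det = t ^ μ.card * dCount N μ := by
  have h := dCount_mul_pow_eq_det N t (rowLen_antitone μ (2 * l + 1))
  rw [diagOf_rowLen hμ, ← card_eq_sum_rowLen hμ] at h
  rw [h]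
  congr 1
  ext i j
  simp only [rowMatrix, jacobiTrudi, Matrix.of_apply, strictSeqOf]
  congr 1
  have := i.2
  omega

open Filter Topology in
theorem hasSum_of_tendsto_strictSeqs {n : ℕ} {g : (Fin n → ℕ) → ℝ} {S : ℝ}
    (hg : ∀ a, StrictAnti a → 0 ≤ g a)
    (h : Tendsto (fun K => ∑ a ∈ strictSeqs n K, g a) atTop (𝓝 S)) :
    HasSum (fun a => if StrictAnti a then g a else 0) S := by
  let B : ℕ → Finset (Fin n → ℕ) := fun K => Fintype.piFinset fun _ => Finset.range K
  have hB : ∀ K, ∑ a ∈ B K, (if StrictAnti a then g a else 0) = ∑ a ∈ strictSeqs n K, g a :=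
    fun K => (Finset.sum_filter _ _).symm
  have hnn : ∀ a, 0 ≤ (if StrictAnti a then g a else 0) := fun a => by
    split_ifs with ha
    · exact hg a ha
    · exact le_rfl
  have hmono : Monotone B := fun K K' hK => Fintype.piFinset_subset _ _ fun _ =>
    Finset.range_mono hK
  have hex : ∀ a, ∃ K, a ∈ B K := fun a =>
    ⟨∑ i, a i + 1, Fintype.mem_piFinset.2 fun i => Finset.mem_range.2
      (Nat.lt_succ_of_le (Finset.single_le_sum (fun _ _ => Nat.zero_le _) (Finset.mem_univ i)))⟩
  have hBt : Tendsto B atTop atTop := tendsto_atTop_finset_of_monotone hmono hex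
  have hle : ∀ K, ∑ a ∈ B K, (if StrictAnti a then g a else 0) ≤ S := fun K => by
    refine Monotone.ge_of_tendsto (f := fun K => ∑ a ∈ B K, (if StrictAnti a then g a else 0))
      (fun K K' hK => Finset.sum_le_sum_of_subset_of_nonneg (hmono hK) fun a _ _ => hnn a) ?_ K
    simpa only [hB] using h
  have hsum : Summable fun a => if StrictAnti a then g a else 0 := by
    refine summable_of_sum_le hnn (c := S) fun F => ?_
    obtain ⟨K, hK⟩ := (hBt.eventually_ge_atTop F).exists
    exact (Finset.sum_le_sum_of_subset_of_nonneg hK fun a _ _ => hnn a).trans (hle K)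
  have h2 : Tendsto (fun K => ∑ a ∈ B K, (if StrictAnti a then g a else 0)) atTop (𝓝 S) := by
    simpa only [hB] using h
  have := tendsto_nhds_unique (hsum.hasSum.comp hBt) h2
  rw [← this]
  exact hsum.hasSum

theorem hasSum_of_tendsto_sum_det {t β S : ℝ} (ht : 0 < t) (hβ : 0 < β) (N l : ℕ)
    (h : Filter.Tendsto (fun K => ∑ a ∈ strictSeqs (2 * l + 1) K,
      seqWeight β a * (rowMatrix (binomCoeff N t) a).det) Filter.atTop (nhds S)) :
    HasSum (fun μ : {μ : YoungDiagram // numRows μ ≤ 2 * l + 1} =>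
      t ^ μ.1.card * β ^ oddCols μ.1 * (dCount N μ.1 : ℝ)) S := by
  have key : ∀ μ : {μ : YoungDiagram // numRows μ ≤ 2 * l + 1},
      seqWeight β (strictSeqOf (2 * l) μ) *
        (rowMatrix (binomCoeff N t) (strictSeqOf (2 * l) μ)).det =
      t ^ μ.1.card * β ^ oddCols μ.1 * (dCount N μ.1 : ℝ) := fun μ => by
    rw [seqWeight_strictSeqOf β μ.2, det_rowMatrix_strictSeqOf N t μ.2]
    ring
  have h1 := hasSum_of_tendsto_strictSeqs (fun a ha => ?_) h
  · rw [← Function.Injective.hasSum_iff (strictSeqOf_injective (2 * l))] at h1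
    · refine h1.congr_fun fun μ => ?_
      rw [← key μ]
      exact (if_pos (strictAnti_strictSeqOf _ _)).symm
    · intro a ha
      exact if_neg fun hs => ha (exists_strictSeqOf_eq hs)
  · obtain ⟨μ, rfl⟩ := exists_strictSeqOf_eq ha
    rw [key]
    positivity

theorem autocorr_binomCoeff_zero (t : ℝ) (d : ℤ) :
    autocorr (binomCoeff 0 t) d = if d = 0 then 1 else 0 := by
  rw [autocorr, tsum_eq_single 0]
  · simp [binomCoeff_zero]
  · intro k hk
    rw [binomCoeff_zero, if_neg hk, zero_mul]

theorem autocorrMatrix_binomCoeff_zero (t : ℝ) (l : ℕ) :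
    autocorrMatrix (binomCoeff 0 t) l = 1 := by
  ext i j
  rw [autocorrMatrix, Matrix.of_apply, autocorr_binomCoeff_zero, autocorr_binomCoeff_zero,
    if_neg (c := (i + j + 2 : ℤ) = 0) (by omega), sub_zero, Matrix.one_apply]
  congr 1
  rw [Fin.ext_iff, eq_iff_iff]
  omega

theorem tailLimit_binomCoeff_zero (t β : ℝ) : tailLimit β (binomCoeff 0 t) 0 0 = 1 := by
  rw [tailLimit, tsum_eq_single 0]
  · simp [binomCoeff_zero]
  · intro d hd
    rw [binomCoeff_zero, if_neg (by omega), mul_zero]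

theorem hasSum_dCount_zero (t β : ℝ) (n : ℕ) :
    HasSum (fun μ : {μ : YoungDiagram // numRows μ ≤ n} =>
      t ^ μ.1.card * β ^ oddCols μ.1 * (dCount 0 μ.1 : ℝ)) 1 := by
  have h0 : numRows ⊥ ≤ n := by simp [numRows, YoungDiagram.colLen_eq_card, YoungDiagram.col]
  have hd : ∀ μ : {μ : YoungDiagram // numRows μ ≤ n},
      dCount 0 μ.1 = if (fun i : Fin n => μ.1.rowLen i) = 0 then 1 else 0 := fun μ => by
    rw [← dCount_zero (rowLen_antitone μ.1 n), diagOf_rowLen μ.2]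
  have hone : ∀ μ : {μ : YoungDiagram // numRows μ ≤ n},
      (fun i : Fin n => μ.1.rowLen i) = 0 → μ = ⟨⊥, h0⟩ := fun μ hμ => by
    apply Subtype.ext
    have h1 : μ.1.card = 0 := by
      rw [card_eq_sum_rowLen μ.2]
      exact Finset.sum_eq_zero fun i _ => congrFun hμ i
    apply YoungDiagram.ext
    exact Finset.card_eq_zero.1 h1
  have h := hasSum_single (f := fun μ : {μ : YoungDiagram // numRows μ ≤ n} =>
      t ^ μ.1.card * β ^ oddCols μ.1 * (dCount 0 μ.1 : ℝ)) ⟨⊥, h0⟩ fun μ hμ => by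
    rw [hd, if_neg fun hc => hμ (hone μ hc)]
    simp
  convert h
  rw [hd, if_pos]
  · have hc : (⊥ : YoungDiagram).card = 0 := by simp [YoungDiagram.card]
    simp [oddCols, hc]
  · funext i
    simp [YoungDiagram.rowLen_eq_card, YoungDiagram.row]

theorem det_combMatrix {t β : ℝ} (ht : 0 < t) (ht1 : t < 1) (hβ : 0 < β)
    (hβt : β * t < 1) {l : ℕ} (hl : 0 < l) :
    ((combMatrix β l).submatrix rowPosition id).det = (-2) ^ l := by
  obtain ⟨D, s, h⟩ := exists_geomDecay_binomCoeff ht ht1 hβ hβt 0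
  have h1 := h.tendsto_sum_strictSeqs_mul hl
  rw [autocorrMatrix_binomCoeff_zero, Matrix.det_one, tailLimit_binomCoeff_zero, mul_one,
    one_mul] at h1
  have hne : ((combMatrix β l).submatrix rowPosition id).det ≠ 0 := fun h0 => by
    simp only [h0, mul_zero] at h1
    exact pow_ne_zero l (by norm_num) (tendsto_nhds_unique h1 tendsto_const_nhds)
  have h2 := h1.mul_const ((combMatrix β l).submatrix rowPosition id).det⁻¹
  simp only [mul_inv_cancel_right₀ hne] at h2
  have h3 := (hasSum_of_tendsto_sum_det ht hβ 0 l h2).unique (hasSum_dCount_zero t β (2 * l + 1))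
  rwa [mul_inv_eq_one₀ hne, eq_comm] at h3

theorem hasSum_dCount {t β : ℝ} (ht : 0 < t) (ht1 : t < 1) (hβ : 0 < β)
    (hβt : β * t < 1) (N : ℕ) {l : ℕ} (hl : 0 < l) :
    HasSum (fun μ : {μ : YoungDiagram // numRows μ ≤ 2 * l + 1} =>
      t ^ μ.1.card * β ^ oddCols μ.1 * (dCount N μ.1 : ℝ))
      (tailLimit β (binomCoeff N t) 0 0 * (autocorrMatrix (binomCoeff N t) l).det) := by
  obtain ⟨D, s, h⟩ := exists_geomDecay_binomCoeff ht ht1 hβ hβt N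
  have h1 := h.tendsto_sum_strictSeqs_mul hl
  rw [det_combMatrix ht ht1 hβ hβt hl] at h1
  have h2 := h1.mul_const (((-2 : ℝ) ^ l)⁻¹)
  have hne : (-2 : ℝ) ^ l ≠ 0 := pow_ne_zero l (by norm_num)
  simp only [mul_inv_cancel_right₀ hne] at h2
  refine hasSum_of_tendsto_sum_det ht hβ N l (h2.trans (le_of_eq ?_))
  congr 1
  field_simp

theorem binomCoeff_succ_natCast (n : ℕ) (t : ℝ) (k : ℕ) :
    binomCoeff (n + 1) t k = ((k + n).choose n : ℝ) * t ^ k := by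
  rw [binomCoeff_natCast, Nat.multichoose_eq, show n + 1 + k - 1 = k + n by omega,
    ← Nat.choose_symm_add (a := k) (b := n)]

theorem tailLimit_binomCoeff {t β : ℝ} (ht : 0 < t) (hβ : 0 < β) (hβt : β * t < 1)
    {N : ℕ} (hN : 0 < N) : tailLimit β (binomCoeff N t) 0 0 = ((1 - β * t) ^ N)⁻¹ := by
  obtain ⟨n, rfl⟩ : ∃ n, N = n + 1 := ⟨N - 1, by omega⟩
  have hr : ‖β * t‖ < 1 := by rwa [Real.norm_of_nonneg (by positivity)]
  rw [← one_div, ← tsum_choose_mul_geometric_of_norm_lt_one n hr, tailLimit]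
  refine tsum_congr fun d => ?_
  rw [show ((0 : ℕ) : ℤ) + d - 0 = d by simp, binomCoeff_succ_natCast]
  ring

theorem hasSum_binomCoeff_mul_pow {t : ℝ} (ht : 0 < t) (ht1 : t < 1) {N : ℕ} (hN : 0 < N)
    (θ : ℝ) :
    HasSum (fun k : ℤ => (binomCoeff N t k : ℂ) * Complex.exp (k * θ * Complex.I))
      ((1 - t * Complex.exp (θ * Complex.I)) ^ N)⁻¹ := by
  obtain ⟨n, rfl⟩ : ∃ n, N = n + 1 := ⟨N - 1, by omega⟩
  have hr : ‖t * Complex.exp (θ * Complex.I)‖ < 1 := by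
    rw [norm_mul, Complex.norm_exp_ofReal_mul_I, mul_one, Complex.norm_of_nonneg ht.le]
    exact ht1
  refine (Nat.cast_injective.hasSum_iff (f := fun k : ℤ =>
    (binomCoeff (n + 1) t k : ℂ) * Complex.exp (k * θ * Complex.I)) fun k hk => ?_).1 ?_
  · rw [binomCoeff_of_neg, Complex.ofReal_zero, zero_mul]
    by_contra hc
    exact hk ⟨k.toNat, by omega⟩
  · rw [← one_div]
    have h := hasSum_choose_mul_geometric_of_norm_lt_one n hr
    refine h.congr_fun fun k => ?_
    rw [Function.comp_apply, binomCoeff_succ_natCast, mul_pow, ← Complex.exp_nat_mul]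
    push_cast
    ring_nf

theorem hasSum_mul_conj {ι : Type*} {f : ι → ℂ} {F : ℂ} (hF : HasSum f F)
    (hn : Summable fun k => ‖f k‖) :
    HasSum (fun p : ι × ι => f p.1 * (starRingEnd ℂ) (f p.2)) (F * (starRingEnd ℂ) F) := by
  obtain ⟨g, hg⟩ : ∃ g : ι → ℂ, ∀ k, g k = (starRingEnd ℂ) (f k) := ⟨_, fun _ => rfl⟩
  have hgn : Summable fun k => ‖g k‖ := hn.congr fun k => by rw [hg, Complex.norm_conj]
  have h := hF.mul ((Complex.hasSum_conj'.2 hF).congr_fun hg) (summable_mul_of_summable_norm hn hgn)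
  simpa only [hg] using h

theorem hasSum_mul_mul_cos {m : ℤ → ℝ} (hm : Summable m) {θ : ℝ} {F : ℂ}
    (hF : HasSum (fun k : ℤ => (m k : ℂ) * Complex.exp (k * θ * Complex.I)) F) :
    HasSum (fun p : ℤ × ℤ => m p.1 * m p.2 * Real.cos (((p.1 - p.2 : ℤ) : ℝ) * θ))
      (Complex.normSq F) := by
  have hn : Summable fun k : ℤ => ‖(m k : ℂ) * Complex.exp (k * θ * Complex.I)‖ := by
    refine hm.abs.congr fun k => ?_
    have := Complex.norm_exp_ofReal_mul_I (k * θ)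
    push_cast at this
    rw [norm_mul, this, mul_one, Complex.norm_real, Real.norm_eq_abs]
  have h := hasSum_mul_conj hF hn
  rw [Complex.mul_conj] at h
  have h2 := Complex.hasSum_re h
  rw [Complex.ofReal_re] at h2
  refine h2.congr_fun fun p => ?_
  rw [map_mul, ← Complex.exp_conj, Complex.conj_ofReal, mul_mul_mul_comm, ← Complex.exp_add,
    ← Complex.ofReal_mul, Complex.re_ofReal_mul, ← Complex.exp_ofReal_mul_I_re]
  congr 3
  simp
  ring

theorem normSq_one_sub_mul_exp (t θ : ℝ) :
    Complex.normSq (1 - t * Complex.exp (θ * Complex.I)) =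
      1 + t ^ 2 - 2 * t * Real.cos θ := by
  rw [Complex.normSq_apply]
  simp [Complex.exp_ofReal_mul_I_re, Complex.exp_ofReal_mul_I_im]
  nlinarith [Real.sin_sq_add_cos_sq θ]

theorem integral_cos_int_mul (n : ℤ) :
    ∫ θ in (0 : ℝ)..Real.pi, Real.cos (n * θ) = if n = 0 then Real.pi else 0 := by
  split_ifs with h
  · simp [h]
  · rw [intervalIntegral.integral_comp_mul_left (fun x => Real.cos x) (Int.cast_ne_zero.2 h)]
    simp

theorem integral_cos_mul_cos (d n : ℤ) :
    ∫ θ in (0 : ℝ)..Real.pi, Real.cos (d * θ) * Real.cos (n * θ) =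
      Real.pi / 2 * ((if n = d then 1 else 0) + if n = -d then 1 else 0) := by
  have h : ∀ θ : ℝ, Real.cos (d * θ) * Real.cos (n * θ) =
      (Real.cos (((n - d : ℤ) : ℝ) * θ) + Real.cos (((n + d : ℤ) : ℝ) * θ)) * (1 / 2) := fun θ => by
    push_cast
    rw [sub_mul, add_mul (n : ℝ), Real.cos_sub, Real.cos_add]
    ring
  simp only [h]
  rw [intervalIntegral.integral_mul_const, intervalIntegral.integral_add
    (Continuous.intervalIntegrable (by fun_prop) _ _)
    (Continuous.intervalIntegrable (by fun_prop) _ _), integral_cos_int_mul, integral_cos_int_mul]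
  simp only [sub_eq_zero, add_eq_zero_iff_eq_neg]
  split_ifs <;> ring

theorem hasSum_ite_sub_eq {m : ℤ → ℝ} {d : ℤ} (hm : Summable fun k => m k * m (k + d)) :
    HasSum (fun p : ℤ × ℤ => m p.1 * m p.2 * if p.1 - p.2 = d then 1 else 0) (autocorr m d) := by
  refine (Function.Injective.hasSum_iff (g := fun k : ℤ => (k + d, k))
    (fun a b h => (Prod.mk.inj h).2) fun p hp => ?_).1 (hm.hasSum.congr_fun fun k => ?_)
  · rw [if_neg, mul_zero]
    exact fun hc => hp ⟨p.2, Prod.ext (by simp; omega) rfl⟩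
  · simp [mul_comm]

theorem integral_cos_mul_eq_autocorr {m : ℤ → ℝ} (hm : Summable m)
    (hm2 : ∀ d, Summable fun k => m k * m (k + d)) {W : ℝ → ℝ}
    (hW : ∀ θ, HasSum
      (fun p : ℤ × ℤ => m p.1 * m p.2 * Real.cos (((p.1 - p.2 : ℤ) : ℝ) * θ)) (W θ)) (d : ℤ) :
    ∫ θ in (0 : ℝ)..Real.pi, Real.cos (d * θ) * W θ = Real.pi * autocorr m d := by
  have hs : Summable fun p : ℤ × ℤ => |m p.1 * m p.2| :=
    summable_mul_of_summable_norm hm.norm hm.norm |>.abs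
  have h1 := intervalIntegral.hasSum_integral_of_dominated_convergence
    (μ := MeasureTheory.volume) (a := 0) (b := Real.pi)
    (F := fun (p : ℤ × ℤ) θ =>
      Real.cos (d * θ) * (m p.1 * m p.2 * Real.cos (((p.1 - p.2 : ℤ) : ℝ) * θ)))
    (f := fun θ => Real.cos (d * θ) * W θ) (fun p _ => |m p.1 * m p.2|)
    (fun p => Continuous.aestronglyMeasurable (by fun_prop))
    (fun p => .of_forall fun θ _ => by
      rw [norm_mul, norm_mul, Real.norm_eq_abs, Real.norm_eq_abs, Real.norm_eq_abs]
      calc _ ≤ 1 * (|m p.1 * m p.2| * 1) := by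
            gcongr
            · exact Real.abs_cos_le_one _
            · exact Real.abs_cos_le_one _
        _ = _ := by ring)
    (.of_forall fun θ _ => hs) intervalIntegrable_const
    (.of_forall fun θ _ => (hW θ).mul_left _)
  have h2 := ((hasSum_ite_sub_eq (hm2 d)).add (hasSum_ite_sub_eq (hm2 (-d)))).mul_left
    (Real.pi / 2)
  rw [autocorr_neg] at h2
  rw [show Real.pi * autocorr m d = Real.pi / 2 * (autocorr m d + autocorr m d) by ring]
  refine h1.unique (h2.congr_fun fun p => ?_)
  rw [← mul_add, mul_left_comm, ← integral_cos_mul_cos, ← intervalIntegral.integral_const_mul]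
  congr 1
  funext θ
  ring

theorem integral_cos_mul_inv {t : ℝ} (ht : 0 < t) (ht1 : t < 1) {N : ℕ} (hN : 0 < N) (d : ℤ) :
    ∫ θ in (0 : ℝ)..Real.pi,
        Real.cos (d * θ) * ((1 + t ^ 2 - 2 * t * Real.cos θ) ^ N)⁻¹ =
      Real.pi * autocorr (binomCoeff N t) d := by
  obtain ⟨D, s, h⟩ := exists_geomDecay_binomCoeff (β := 1) ht ht1 one_pos (by linarith) N
  refine integral_cos_mul_eq_autocorr h.summable (fun e => ?_) (fun θ => ?_) d
  · simpa using h.summable_shift_mul_shift 0 (-e)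
  · rw [← normSq_one_sub_mul_exp, ← map_pow, ← map_inv₀]
    exact hasSum_mul_mul_cos h.summable (hasSum_binomCoeff_mul_pow ht ht1 hN θ)

theorem integral_mul_sqrt_one_sub_sq (f : ℝ → ℝ) :
    ∫ x in (-1 : ℝ)..1, f x * Real.sqrt (1 - x ^ 2) =
      ∫ θ in (0 : ℝ)..Real.pi, f (Real.cos θ) * Real.sin θ ^ 2 := by
  have h := (Polynomial.Chebyshev.integral_measureT fun x => f x * (1 - x ^ 2)).symm.trans
    Polynomial.Chebyshev.integral_measureT_eq_integral_cos
  simp only [← Real.sin_sq] at h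
  rw [← h]
  refine intervalIntegral.integral_congr fun x hx => ?_
  rw [Set.uIcc_of_le (by norm_num)] at hx
  have hx2 : 0 ≤ 1 - x ^ 2 := by nlinarith [hx.1, hx.2]
  simp only [mul_assoc]
  congr 1
  rw [Real.sqrt_inv, ← div_eq_mul_inv, Real.div_sqrt]

theorem integral_eval_U_mul_eval_U (j k : ℕ) (w : ℝ → ℝ) :
    ∫ x in (-1 : ℝ)..1, (Polynomial.Chebyshev.U ℝ j).eval x *
        (Polynomial.Chebyshev.U ℝ k).eval x * w x * Real.sqrt (1 - x ^ 2) =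
      ∫ θ in (0 : ℝ)..Real.pi,
        Real.sin ((j + 1) * θ) * Real.sin ((k + 1) * θ) * w (Real.cos θ) := by
  rw [integral_mul_sqrt_one_sub_sq]
  congr 1
  funext θ
  have hj := Polynomial.Chebyshev.U_real_cos θ j
  have hk := Polynomial.Chebyshev.U_real_cos θ k
  rw [Int.cast_natCast] at hj hk
  rw [← hj, ← hk]
  ring

theorem one_add_sq_sub_pos {t x : ℝ} (ht : 0 < t) (ht1 : t < 1) (hx : x ≤ 1) :
    0 < 1 + t ^ 2 - 2 * t * x := by
  nlinarith [mul_le_mul_of_nonneg_left hx ht.le, mul_pos (sub_pos.2 ht1) (sub_pos.2 ht1)]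

theorem autocorrMatrix_apply_eq_integral {t : ℝ} (ht : 0 < t) (ht1 : t < 1) {N : ℕ}
    (hN : 0 < N) {l : ℕ} (j k : Fin l) :
    autocorrMatrix (binomCoeff N t) l j k =
      2 / Real.pi * ∫ x in (-1 : ℝ)..1, (Polynomial.Chebyshev.U ℝ (j : ℕ)).eval x *
        (Polynomial.Chebyshev.U ℝ (k : ℕ)).eval x * ((1 + t ^ 2 - 2 * t * x) ^ N)⁻¹ *
          Real.sqrt (1 - x ^ 2) := by
  have hW : Continuous fun θ => ((1 + t ^ 2 - 2 * t * Real.cos θ) ^ N)⁻¹ :=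
    Continuous.inv₀ (by fun_prop) fun θ =>
      (pow_pos (one_add_sq_sub_pos ht ht1 (Real.cos_le_one θ)) N).ne'
  rw [integral_eval_U_mul_eval_U (j : ℕ) (k : ℕ) fun x => ((1 + t ^ 2 - 2 * t * x) ^ N)⁻¹]
  have h : ∀ θ : ℝ, Real.sin (((j : ℕ) + 1) * θ) * Real.sin (((k : ℕ) + 1) * θ) *
        ((1 + t ^ 2 - 2 * t * Real.cos θ) ^ N)⁻¹ =
      1 / 2 * (Real.cos (((j - k : ℤ) : ℝ) * θ) * ((1 + t ^ 2 - 2 * t * Real.cos θ) ^ N)⁻¹ -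
        Real.cos (((j + k + 2 : ℤ) : ℝ) * θ) * ((1 + t ^ 2 - 2 * t * Real.cos θ) ^ N)⁻¹) :=
      fun θ => by
    rw [show ((j - k : ℤ) : ℝ) * θ = ((j : ℕ) + 1) * θ - ((k : ℕ) + 1) * θ by push_cast; ring,
      show ((j + k + 2 : ℤ) : ℝ) * θ = ((j : ℕ) + 1) * θ + ((k : ℕ) + 1) * θ by push_cast; ring,
      Real.cos_sub, Real.cos_add]
    ring
  simp only [h]
  rw [intervalIntegral.integral_const_mul, intervalIntegral.integral_sub
    (Continuous.intervalIntegrable (by fun_prop) _ _)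
    (Continuous.intervalIntegrable (by fun_prop) _ _), integral_cos_mul_inv ht ht1 hN,
    integral_cos_mul_inv ht ht1 hN, autocorrMatrix, Matrix.of_apply]
  field_simp

theorem det_integral_eval_mul_eval {l : ℕ} (p : Fin l → Polynomial ℝ)
    (hp : ∀ j, (p j).natDegree = j) {w : ℝ → ℝ} {a b : ℝ} (hw : ContinuousOn w (Set.uIcc a b)) :
    (Matrix.of fun j k : Fin l => ∫ x in a..b, (p j).eval x * (p k).eval x * w x).det =
      (∏ j, (p j).leadingCoeff) ^ 2 *
        (Matrix.of fun j k : Fin l => ∫ x in a..b, x ^ ((j : ℕ) + (k : ℕ)) * w x).det := by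
  set P : Matrix (Fin l) (Fin l) ℝ := Matrix.of fun j i => (p j).coeff i with hP
  have hdet : P.det = ∏ j, (p j).leadingCoeff := by
    rw [Matrix.det_of_isLowerTriangular]
    · refine Finset.prod_congr rfl fun j _ => ?_
      rw [hP, Matrix.of_apply, Polynomial.leadingCoeff, hp]
    · intro j i hji
      exact Polynomial.coeff_eq_zero_of_natDegree_lt (by rw [hp]; exact hji)
  have hmul : (Matrix.of fun j k : Fin l => ∫ x in a..b, (p j).eval x * (p k).eval x * w x) =
      P * (Matrix.of fun j k : Fin l => ∫ x in a..b, x ^ ((j : ℕ) + (k : ℕ)) * w x) *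
        P.transpose := by
    ext j k
    have heval : ∀ (j : Fin l) (x : ℝ), (p j).eval x = ∑ i : Fin l, (p j).coeff i * x ^ (i : ℕ) :=
      fun j x => by
        rw [Polynomial.eval_eq_sum_range' (n := l) (by rw [hp]; exact j.2),
          ← Fin.sum_univ_eq_sum_range fun i => (p j).coeff i * x ^ i]
    have hterm_int : ∀ (i i' : Fin l), IntervalIntegrable
        (fun x => (p j).coeff i * (p k).coeff i' * (x ^ ((i : ℕ) + (i' : ℕ)) * w x))
        MeasureTheory.volume a b := fun i i' =>
      ContinuousOn.intervalIntegrable (by fun_prop)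
    have hsum_int : ∀ i : Fin l, IntervalIntegrable
        (fun x => ∑ i' : Fin l, (p j).coeff i * (p k).coeff i' * (x ^ ((i : ℕ) + (i' : ℕ)) * w x))
        MeasureTheory.volume a b := fun i =>
      ContinuousOn.intervalIntegrable (by fun_prop)
    have hexp : ∀ x, (p j).eval x * (p k).eval x * w x = ∑ i : Fin l, ∑ i' : Fin l,
        (p j).coeff i * (p k).coeff i' * (x ^ ((i : ℕ) + (i' : ℕ)) * w x) := fun x => by
      rw [heval, heval, Finset.sum_mul_sum, Finset.sum_mul]
      refine Finset.sum_congr rfl fun i _ => ?_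
      rw [Finset.sum_mul]
      refine Finset.sum_congr rfl fun i' _ => ?_
      ring
    simp only [Matrix.of_apply, hexp]
    rw [intervalIntegral.integral_finsetSum fun i _ => hsum_int i,
      Matrix.mul_assoc, Matrix.mul_apply]
    refine Finset.sum_congr rfl fun i _ => ?_
    rw [intervalIntegral.integral_finsetSum fun i' _ => hterm_int i i', Matrix.mul_apply,
      Finset.mul_sum]
    refine Finset.sum_congr rfl fun i' _ => ?_
    rw [intervalIntegral.integral_const_mul, hP, Matrix.transpose_apply, Matrix.of_apply,
      Matrix.of_apply, Matrix.of_apply]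
    ring
  rw [hmul, Matrix.det_mul, Matrix.det_mul, Matrix.det_transpose, hdet]
  ring

theorem det_autocorrMatrix_binomCoeff {t : ℝ} (ht : 0 < t) (ht1 : t < 1) {N : ℕ}
    (hN : 0 < N) (l : ℕ) :
    (autocorrMatrix (binomCoeff N t) l).det =
      Matrix.det (Matrix.of fun j k : Fin l =>
        (2 ^ ((j : ℕ) + (k : ℕ) + 1) / Real.pi) *
          ∫ x in (-1 : ℝ)..1,
            x ^ ((j : ℕ) + (k : ℕ)) * ((1 + t ^ 2 - 2 * t * x) ^ N)⁻¹ *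
              Real.sqrt (1 - x ^ 2)) := by
  set w : ℝ → ℝ := fun x => ((1 + t ^ 2 - 2 * t * x) ^ N)⁻¹ * Real.sqrt (1 - x ^ 2) with hw
  have hwc : ContinuousOn w (Set.uIcc (-1) 1) := by
    refine ContinuousOn.mul (ContinuousOn.inv₀ (by fun_prop) fun x hx => ?_) (by fun_prop)
    rw [Set.uIcc_of_le (by norm_num)] at hx
    exact (pow_pos (one_add_sq_sub_pos ht ht1 hx.2) N).ne'
  have h1 : autocorrMatrix (binomCoeff N t) l = (2 / Real.pi) • Matrix.of fun j k : Fin l =>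
      ∫ x in (-1 : ℝ)..1, (Polynomial.Chebyshev.U ℝ (j : ℕ)).eval x *
        (Polynomial.Chebyshev.U ℝ (k : ℕ)).eval x * w x := by
    ext j k
    rw [autocorrMatrix_apply_eq_integral ht ht1 hN]
    simp only [hw, Matrix.smul_apply, Matrix.of_apply, smul_eq_mul, mul_assoc]
  have h2 : (Matrix.of fun j k : Fin l =>
        (2 ^ ((j : ℕ) + (k : ℕ) + 1) / Real.pi) *
          ∫ x in (-1 : ℝ)..1,
            x ^ ((j : ℕ) + (k : ℕ)) * ((1 + t ^ 2 - 2 * t * x) ^ N)⁻¹ *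
              Real.sqrt (1 - x ^ 2)) =
      (2 / Real.pi) • Matrix.of fun j k : Fin l => 2 ^ (j : ℕ) *
        (Matrix.of fun j k : Fin l => 2 ^ (k : ℕ) *
          (Matrix.of fun j k : Fin l =>
            ∫ x in (-1 : ℝ)..1, x ^ ((j : ℕ) + (k : ℕ)) * w x) j k) j k := by
    ext j k
    simp only [hw, Matrix.smul_apply, Matrix.of_apply, smul_eq_mul, mul_assoc]
    ring
  rw [h1, h2, Matrix.det_smul, Matrix.det_smul,
    det_integral_eval_mul_eval _ (fun j => Polynomial.Chebyshev.natDegree_U_natCast ℝ j) hwc,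
    Matrix.det_mul_column, Matrix.det_mul_row]
  simp only [Polynomial.Chebyshev.leadingCoeff_U_natCast]
  ring

/-- `φ(N, 2l+1, t, β) = (1-t²)^{N(N-1)/2} det H_l` with the Hankel matrix
`h_{jk} = (2^{j+k+1}/π) ∫_{-1}^1 x^{j+k} (1+t²-2tx)^{-N} (1-x²)^{1/2} dx`. -/
theorem hankel_det_formula (t β : ℝ) (ht : 0 < t) (ht1 : t < 1)
    (hβ : 0 < β) (hβt : β * t < 1) (N l : ℕ) (hN : 0 < N) (hl : 0 < l) :
    phiGF N (2 * l + 1) t β =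
      (1 - t ^ 2) ^ (N * (N - 1) / 2) *
        Matrix.det (Matrix.of fun j k : Fin l =>
          (2 ^ ((j : ℕ) + (k : ℕ) + 1) / Real.pi) *
            ∫ x in (-1 : ℝ)..1,
              x ^ ((j : ℕ) + (k : ℕ)) * ((1 + t ^ 2 - 2 * t * x) ^ N)⁻¹ *
                Real.sqrt (1 - x ^ 2)) := by
  rw [phiGF, (hasSum_dCount ht ht1 hβ hβt N hl).tsum_eq, tailLimit_binomCoeff ht hβ hβt hN,
    det_autocorrMatrix_binomCoeff ht ht1 hN, mul_assoc,
    mul_inv_cancel_left₀ (pow_ne_zero N (sub_pos.2 hβt).ne')]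
end
end

section
/- Fix a real number t with 0 < t < 1, a real number β > 0 with βt < 1, and a positive integer N. Then the sum over all partitions λ (of all sizes) of t^{|λ|} β^{f(λ')} d_λ(N) converges and equals (1-t²)^{-N(N-1)/2} (1-βt)^{-N}. -/
open scoped Classical

noncomputable section

open scoped ENNReal

namespace YoungDiagram

/-- The Young diagram whose rows have the lengths `a 0, a 1, …`. -/
def ofAntitone (a : ℕ → ℕ) (ha : Antitone a) (h0 : ∃ n, a n = 0) : YoungDiagram where
  cells := (Finset.range h0.choose ×ˢ Finset.range (a 0)).filter fun c => c.2 < a c.1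
  isLowerSet := by
    rintro ⟨i, j⟩ ⟨i', j'⟩ ⟨hi, hj⟩ h
    simp only [Finset.coe_filter, Finset.mem_product, Finset.mem_range, Set.mem_ofPred_eq] at h ⊢
    have := ha hi
    simp only at hi hj this
    omega

theorem rowLen_ofAntitone {a : ℕ → ℕ} (ha : Antitone a) (h0 : ∃ n, a n = 0) (i : ℕ) :
    (ofAntitone a ha h0).rowLen i = a i := by
  have key : ∀ j, (i, j) ∈ ofAntitone a ha h0 ↔ j < a i := by
    intro j
    rw [← mem_cells]
    simp only [ofAntitone, Finset.mem_filter, Finset.mem_product, Finset.mem_range,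
      and_iff_right_iff_imp]
    intro h
    refine ⟨?_, h.trans_le (ha (Nat.zero_le i))⟩
    by_contra! hi
    have := ha hi
    have := h0.choose_spec
    omega
  refine eq_of_forall_lt_iff fun j => ?_
  rw [← mem_iff_lt_rowLen, key]

theorem ext_rowLen {μ ν : YoungDiagram} (h : ∀ i, μ.rowLen i = ν.rowLen i) : μ = ν := by
  refine SetLike.ext fun ⟨i, j⟩ => ?_
  rw [mem_iff_lt_rowLen, mem_iff_lt_rowLen, h]

theorem rowLen_eq_zero_of_card_le (μ : YoungDiagram) {i : ℕ} (hi : μ.card ≤ i) :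
    μ.rowLen i = 0 := by
  by_contra h
  have hsub : (Finset.range (i + 1)).image (fun k => (k, 0)) ⊆ μ.cells := by
    intro c hc
    simp only [Finset.mem_image, Finset.mem_range] at hc
    obtain ⟨k, hk, rfl⟩ := hc
    rw [mem_cells, mem_iff_lt_rowLen]
    have := μ.rowLen_anti k i (by omega)
    omega
  have := Finset.card_le_card hsub
  rw [Finset.card_image_of_injective _ (fun a b h => by simpa using h), Finset.card_range] at this
  change i + 1 ≤ μ.card at this
  omega

theorem card_eq_sum_rowLen (μ : YoungDiagram) {n : ℕ} (hn : μ.card ≤ n) :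
    μ.card = ∑ i ∈ Finset.range n, μ.rowLen i := by
  have : μ.cells = (Finset.range n).biUnion μ.row := by
    ext ⟨i, j⟩
    simp only [Finset.mem_biUnion, Finset.mem_range, mem_row_iff, mem_cells]
    constructor
    · intro h
      refine ⟨i, ?_, h, rfl⟩
      by_contra! hi
      rw [mem_iff_lt_rowLen, μ.rowLen_eq_zero_of_card_le (hn.trans hi)] at h
      omega
    · rintro ⟨_, _, h, _⟩
      exact h
  rw [YoungDiagram.card, this, Finset.card_biUnion]
  · simp only [rowLen_eq_card]
  · intro a _ b _ hab
    rw [Function.onFun, Finset.disjoint_left]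
    intro c hc hc'
    rw [mem_row_iff] at hc hc'
    exact hab (hc.2.symm.trans hc'.2)

theorem rowLen_le_card (μ : YoungDiagram) (i : ℕ) : μ.rowLen i ≤ μ.card := by
  rw [rowLen_eq_card]
  exact Finset.card_le_card (Finset.filter_subset _ _)

theorem oddCols_eq_sum_rowLen (μ : YoungDiagram) {n : ℕ} (hn : μ.card ≤ n) :
    (oddCols μ : ℤ) = ∑ i ∈ Finset.range n, (-1) ^ i * (μ.rowLen i : ℤ) := by
  have hcol : ∀ j, (if Odd (μ.colLen j) then (1 : ℤ) else 0) =
      ∑ i ∈ Finset.range n, if j < μ.rowLen i then (-1) ^ i else 0 := by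
    intro j
    have hle : μ.colLen j ≤ n := by
      by_contra! h
      rw [← mem_iff_lt_colLen, mem_iff_lt_rowLen, μ.rowLen_eq_zero_of_card_le hn] at h
      omega
    rw [← Finset.sum_filter]
    have : (Finset.range n).filter (fun i => j < μ.rowLen i) = Finset.range (μ.colLen j) := by
      ext i
      rw [Finset.mem_filter, ← mem_iff_lt_rowLen, mem_iff_lt_colLen, Finset.mem_range,
        Finset.mem_range]
      omega
    rw [this, neg_one_geom_sum]
    simp only [← Nat.not_even_iff_odd, ite_not]
  rw [oddCols, Finset.card_filter]
  push_cast
  simp only [hcol]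
  rw [Finset.sum_comm]
  refine Finset.sum_congr rfl fun i _ => ?_
  rw [← Finset.sum_filter, Finset.sum_const, nsmul_eq_mul, mul_comm]
  congr 2
  have : (Finset.range μ.card).filter (fun j => j < μ.rowLen i) =
      Finset.range (μ.rowLen i) := by
    ext j
    have := μ.rowLen_le_card i
    simp only [Finset.mem_filter, Finset.mem_range]
    omega
  rw [this, Finset.card_range]

/-- `μ.Interlaces l`: the skew shape `l / μ` is a horizontal strip. -/
def Interlaces (μ l : YoungDiagram) : Prop :=
  ∀ i, l.rowLen (i + 1) ≤ μ.rowLen i ∧ μ.rowLen i ≤ l.rowLen i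

theorem Interlaces.le {μ l : YoungDiagram} (h : μ.Interlaces l) : μ ≤ l := by
  rw [← SetLike.coe_subset_coe]
  rintro ⟨i, j⟩ hij
  rw [SetLike.mem_coe, mem_iff_lt_rowLen] at hij ⊢
  exact hij.trans_le (h i).2

theorem Interlaces.card_le {μ l : YoungDiagram} (h : μ.Interlaces l) : μ.card ≤ l.card :=
  Finset.card_le_card (cells_subset_iff.2 h.le)

theorem rowLen_bot (i : ℕ) : (⊥ : YoungDiagram).rowLen i = 0 := by
  by_contra h
  have := mem_iff_lt_rowLen.2 (Nat.pos_of_ne_zero h)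
  exact notMem_bot _ this

theorem card_bot : (⊥ : YoungDiagram).card = 0 := rfl

theorem interlaces_bot {μ : YoungDiagram} : μ.Interlaces ⊥ ↔ μ = ⊥ := by
  constructor
  · intro h
    exact le_bot_iff.1 h.le
  · rintro rfl i
    simp [rowLen_bot]

/-- The row lengths of the local growth rule with parameter `k`. -/
def growRow (a b : YoungDiagram) (k : ℕ) (c : YoungDiagram) : ℕ → ℕ
  | 0 => max (a.rowLen 0) (b.rowLen 0) + k
  | i + 1 => min (a.rowLen i) (b.rowLen i) + max (a.rowLen (i + 1)) (b.rowLen (i + 1)) - c.rowLen i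

/-- The row lengths of the inverse of the local growth rule. -/
def shrinkRow (a b m : YoungDiagram) (i : ℕ) : ℕ :=
  min (a.rowLen i) (b.rowLen i) + max (a.rowLen (i + 1)) (b.rowLen (i + 1)) - m.rowLen (i + 1)

theorem growRow_interlaces {a b c : YoungDiagram} (k : ℕ) (ha : c.Interlaces a)
    (hb : c.Interlaces b) (i : ℕ) :
    growRow a b k c (i + 1) ≤ min (a.rowLen i) (b.rowLen i) ∧
      max (a.rowLen i) (b.rowLen i) ≤ growRow a b k c i := by
  have h1 := ha i
  have h2 := hb i
  cases i with
  | zero => simp only [growRow]; omega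
  | succ i =>
    have h3 := ha i
    have h4 := hb i
    simp only [growRow]
    omega

theorem antitone_growRow {a b c : YoungDiagram} (k : ℕ) (ha : c.Interlaces a)
    (hb : c.Interlaces b) : Antitone (growRow a b k c) :=
  antitone_nat_of_succ_le fun i => by
    have := growRow_interlaces k ha hb i
    omega

theorem growRow_eventually_zero {a b c : YoungDiagram} (k : ℕ) (ha : c.Interlaces a)
    (hb : c.Interlaces b) : ∃ n, growRow a b k c n = 0 := by
  refine ⟨a.card + 1, ?_⟩
  have h := (growRow_interlaces k ha hb a.card).1
  rw [a.rowLen_eq_zero_of_card_le le_rfl] at h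
  omega

theorem shrinkRow_interlaces {a b m : YoungDiagram} (ha : a.Interlaces m)
    (hb : b.Interlaces m) (i : ℕ) :
    shrinkRow a b m i ≤ min (a.rowLen i) (b.rowLen i) ∧
      max (a.rowLen (i + 1)) (b.rowLen (i + 1)) ≤ shrinkRow a b m i := by
  have h1 := ha i
  have h2 := hb i
  have h3 := ha (i + 1)
  have h4 := hb (i + 1)
  simp only [shrinkRow]
  omega

theorem antitone_shrinkRow {a b m : YoungDiagram} (ha : a.Interlaces m)
    (hb : b.Interlaces m) : Antitone (shrinkRow a b m) :=
  antitone_nat_of_succ_le fun i => by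
    have := shrinkRow_interlaces ha hb i
    have := shrinkRow_interlaces ha hb (i + 1)
    omega

theorem shrinkRow_eventually_zero {a b m : YoungDiagram} (ha : a.Interlaces m)
    (hb : b.Interlaces m) : ∃ n, shrinkRow a b m n = 0 := by
  refine ⟨a.card, ?_⟩
  have h := (shrinkRow_interlaces ha hb a.card).1
  rw [a.rowLen_eq_zero_of_card_le le_rfl] at h
  omega

/-- The local growth rule: a horizontal strip extension `m` of both `a` and `b` is the same as a
natural number together with a common horizontal strip restriction `c` of `a` and `b`. -/
def growth (a b : YoungDiagram) :
    ℕ × {c : YoungDiagram | c.Interlaces a ∧ c.Interlaces b} ≃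
      {m : YoungDiagram | a.Interlaces m ∧ b.Interlaces m} where
  toFun p := ⟨ofAntitone (growRow a b p.1 p.2) (antitone_growRow _ p.2.2.1 p.2.2.2)
      (growRow_eventually_zero _ p.2.2.1 p.2.2.2), by
    constructor <;> intro i <;> rw [rowLen_ofAntitone, rowLen_ofAntitone] <;>
    · have := growRow_interlaces p.1 p.2.2.1 p.2.2.2 i
      omega⟩
  invFun m := (m.1.rowLen 0 - max (a.rowLen 0) (b.rowLen 0),
    ⟨ofAntitone (shrinkRow a b m) (antitone_shrinkRow m.2.1 m.2.2)
      (shrinkRow_eventually_zero m.2.1 m.2.2), by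
    constructor <;> intro i <;> rw [rowLen_ofAntitone] <;>
    · have := shrinkRow_interlaces m.2.1 m.2.2 i
      omega⟩)
  left_inv := by
    rintro ⟨k, c, ha, hb⟩
    refine Prod.ext ?_ (Subtype.ext (ext_rowLen fun i => ?_))
    · simp only [rowLen_ofAntitone, growRow]
      omega
    · have h1 := ha i
      have h2 := hb i
      simp only [rowLen_ofAntitone, shrinkRow, growRow]
      omega
  right_inv := by
    rintro ⟨m, ha, hb⟩
    refine Subtype.ext (ext_rowLen fun i => ?_)
    have h1 := ha i
    have h2 := hb i
    cases i with
    | zero =>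
      simp only [rowLen_ofAntitone, growRow]
      omega
    | succ i =>
      have h3 := ha i
      have h4 := hb i
      simp only [rowLen_ofAntitone, shrinkRow, growRow]
      omega

theorem rowLen_growth_zero (a b : YoungDiagram)
    (p : ℕ × {c : YoungDiagram | c.Interlaces a ∧ c.Interlaces b}) :
    (growth a b p).1.rowLen 0 = max (a.rowLen 0) (b.rowLen 0) + p.1 :=
  rowLen_ofAntitone (antitone_growRow p.1 p.2.2.1 p.2.2.2)
    (growRow_eventually_zero p.1 p.2.2.1 p.2.2.2) 0

theorem rowLen_growth_succ (a b : YoungDiagram)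
    (p : ℕ × {c : YoungDiagram | c.Interlaces a ∧ c.Interlaces b}) (i : ℕ) :
    (growth a b p).1.rowLen (i + 1) + p.2.1.rowLen i =
      min (a.rowLen i) (b.rowLen i) + max (a.rowLen (i + 1)) (b.rowLen (i + 1)) := by
  have h : (growth a b p).1.rowLen (i + 1) = growRow a b p.1 p.2.1 (i + 1) :=
    rowLen_ofAntitone (antitone_growRow p.1 p.2.2.1 p.2.2.2)
      (growRow_eventually_zero p.1 p.2.2.1 p.2.2.2) (i + 1)
  have h1 := p.2.2.1 i
  have h2 := p.2.2.2 i
  rw [h]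
  simp only [growRow]
  omega

theorem card_growth (a b : YoungDiagram)
    (p : ℕ × {c : YoungDiagram | c.Interlaces a ∧ c.Interlaces b}) :
    (growth a b p).1.card + p.2.1.card = p.1 + a.card + b.card := by
  set m := (growth a b p).1
  obtain ⟨n, hn⟩ : ∃ n, n = m.card + p.2.1.card + a.card + b.card := ⟨_, rfl⟩
  have hsum : ∀ r, ∑ i ∈ Finset.range (r + 1), m.rowLen i +
      ∑ i ∈ Finset.range r, p.2.1.rowLen i + min (a.rowLen r) (b.rowLen r) =
      p.1 + ∑ i ∈ Finset.range (r + 1), a.rowLen i + ∑ i ∈ Finset.range (r + 1), b.rowLen i := by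
    intro r
    induction r with
    | zero =>
      have : m.rowLen 0 = _ := rowLen_growth_zero a b p
      simp only [zero_add, Finset.sum_range_one, Finset.sum_range_zero]
      omega
    | succ r ih =>
      have : m.rowLen (r + 1) + _ = _ := rowLen_growth_succ a b p r
      rw [Finset.sum_range_succ m.rowLen (r + 1), Finset.sum_range_succ p.2.1.rowLen r,
        Finset.sum_range_succ a.rowLen (r + 1), Finset.sum_range_succ b.rowLen (r + 1)]
      omega
  have h := hsum n
  rw [← card_eq_sum_rowLen m (by omega), ← card_eq_sum_rowLen p.2.1 (by omega),
    ← card_eq_sum_rowLen a (by omega), ← card_eq_sum_rowLen b (by omega),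
    a.rowLen_eq_zero_of_card_le (by omega)] at h
  omega

theorem oddCols_growth_self (a : YoungDiagram)
    (p : ℕ × {c : YoungDiagram | c.Interlaces a ∧ c.Interlaces a}) :
    oddCols (growth a a p).1 = p.1 + oddCols p.2.1 := by
  set m := (growth a a p).1
  obtain ⟨n, hn⟩ : ∃ n, n = m.card + p.2.1.card + a.card := ⟨_, rfl⟩
  have hsum : ∀ r, ∑ i ∈ Finset.range (r + 1), (-1 : ℤ) ^ i * (m.rowLen i : ℤ) =
      p.1 + ∑ i ∈ Finset.range r, (-1 : ℤ) ^ i * (p.2.1.rowLen i : ℤ) +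
        (-1) ^ r * (a.rowLen r : ℤ) := by
    intro r
    induction r with
    | zero =>
      have := rowLen_growth_zero a a p
      rw [max_self] at this
      simp only [zero_add, Finset.sum_range_one, Finset.sum_range_zero, pow_zero, one_mul, m, this]
      push_cast
      ring
    | succ r ih =>
      have h := rowLen_growth_succ a a p r
      rw [max_self, min_self] at h
      have h' : (m.rowLen (r + 1) : ℤ) = a.rowLen r + a.rowLen (r + 1) - p.2.1.rowLen r := by
        simp only [m]
        omega
      rw [Finset.sum_range_succ _ (r + 1), ih, Finset.sum_range_succ _ r, h']
      ring
  have h := hsum n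
  rw [← oddCols_eq_sum_rowLen m (by omega), ← oddCols_eq_sum_rowLen p.2.1 (by omega),
    a.rowLen_eq_zero_of_card_le (by omega)] at h
  simp only [Nat.cast_zero, mul_zero, add_zero] at h
  exact_mod_cast h

/-- The weighted transfer kernel that adds a horizontal strip to `μ`. -/
def stripWeight (t : ℝ≥0∞) (l μ : YoungDiagram) : ℝ≥0∞ :=
  if μ.Interlaces l then t ^ (l.card - μ.card) else 0

theorem tsum_stripWeight_mul_stripWeight (t : ℝ≥0∞) (a b : YoungDiagram) :
    ∑' m, stripWeight t m a * stripWeight t m b =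
      (∑' k : ℕ, (t ^ 2) ^ k) * ∑' c, stripWeight t a c * stripWeight t b c := by
  have h1 : ∀ m, stripWeight t m a * stripWeight t m b =
      {m : YoungDiagram | a.Interlaces m ∧ b.Interlaces m}.indicator
        (fun m => t ^ (m.card - a.card) * t ^ (m.card - b.card)) m := by
    intro m
    simp only [stripWeight, Set.indicator, Set.mem_ofPred_eq, ite_and]
    split_ifs <;> simp
  have h2 : ∀ c, stripWeight t a c * stripWeight t b c =
      {c : YoungDiagram | c.Interlaces a ∧ c.Interlaces b}.indicator
        (fun c => t ^ (a.card - c.card) * t ^ (b.card - c.card)) c := by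
    intro m
    simp only [stripWeight, Set.indicator, Set.mem_ofPred_eq, ite_and]
    split_ifs <;> simp
  simp only [h1, h2]
  rw [← tsum_subtype, ← tsum_subtype, ← (growth a b).tsum_eq, ENNReal.tsum_prod',
    ← ENNReal.tsum_mul_right]
  refine tsum_congr fun k => ?_
  rw [← ENNReal.tsum_mul_left]
  refine tsum_congr fun c => ?_
  have hcard := card_growth a b (k, c)
  have hc := c.2.1.card_le
  have hc' := c.2.2.card_le
  have hm := (growth a b (k, c)).2.1.card_le
  have hm' := (growth a b (k, c)).2.2.card_le
  simp only [← pow_mul, ← pow_add] at hcard ⊢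
  congr 1
  omega

theorem tsum_oddCols_mul_stripWeight (t β : ℝ≥0∞) (a : YoungDiagram) :
    ∑' l, β ^ oddCols l * stripWeight t l a =
      (∑' k : ℕ, (β * t) ^ k) * ∑' c, β ^ oddCols c * stripWeight t a c := by
  have h1 : ∀ m, β ^ oddCols m * stripWeight t m a =
      {m : YoungDiagram | a.Interlaces m ∧ a.Interlaces m}.indicator
        (fun m => β ^ oddCols m * t ^ (m.card - a.card)) m := by
    intro m
    simp only [stripWeight, Set.indicator, Set.mem_ofPred_eq, and_self]
    split_ifs <;> simp
  have h2 : ∀ c, β ^ oddCols c * stripWeight t a c =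
      {c : YoungDiagram | c.Interlaces a ∧ c.Interlaces a}.indicator
        (fun c => β ^ oddCols c * t ^ (a.card - c.card)) c := by
    intro m
    simp only [stripWeight, Set.indicator, Set.mem_ofPred_eq, and_self]
    split_ifs <;> simp
  simp only [h1, h2]
  rw [← tsum_subtype, ← tsum_subtype, ← (growth a a).tsum_eq, ENNReal.tsum_prod',
    ← ENNReal.tsum_mul_right]
  refine tsum_congr fun k => ?_
  rw [← ENNReal.tsum_mul_left]
  refine tsum_congr fun c => ?_
  have hcard := card_growth a a (k, c)
  have hc := c.2.1.card_le
  have hm := (growth a a (k, c)).2.1.card_le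
  have hexp : (growth a a (k, c)).1.card - a.card = k + (a.card - c.1.card) := by
    simp only at hcard
    omega
  rw [oddCols_growth_self, hexp, pow_add, pow_add, mul_pow]
  ring

/-- The cells of a tableau whose entry is at most `N`. -/
def subshape {l : YoungDiagram} (T : SemistandardYoungTableau l) (N : ℕ) : YoungDiagram where
  cells := l.cells.filter fun c => T c.1 c.2 ≤ N
  isLowerSet := by
    rintro ⟨i, j⟩ ⟨i', j'⟩ ⟨hi, hj⟩ h
    simp only [Finset.coe_filter, mem_cells, Set.mem_ofPred_eq] at h hi hj ⊢
    refine ⟨l.up_left_mem hi hj h.1, ?_⟩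
    exact ((T.row_weak_of_le hj (l.up_left_mem hi le_rfl h.1)).trans (T.col_weak hi h.1)).trans h.2

theorem mem_subshape {l : YoungDiagram} {T : SemistandardYoungTableau l} {N i j : ℕ} :
    (i, j) ∈ subshape T N ↔ (i, j) ∈ l ∧ T i j ≤ N := by
  rw [← mem_cells]
  simp [subshape]

theorem interlaces_iff_mem {μ l : YoungDiagram} :
    μ.Interlaces l ↔ (∀ i j, (i + 1, j) ∈ l → (i, j) ∈ μ) ∧ ∀ i j, (i, j) ∈ μ → (i, j) ∈ l := by
  simp only [mem_iff_lt_rowLen, Interlaces, ← forall_and]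
  refine forall_congr' fun i => ?_
  rw [forall_and, ← forall_lt_iff_le, ← forall_lt_iff_le]

theorem sigma_SSYTN_ext {N : ℕ} {P : YoungDiagram → Prop}
    {p q : Σ μ : {μ : YoungDiagram // P μ}, SSYTN N μ} (h : p.1.1 = q.1.1)
    (hpq : ∀ i j, p.2.1 i j = q.2.1 i j) : p = q := by
  obtain ⟨⟨μ, hμ⟩, S⟩ := p
  obtain ⟨⟨ν, hν⟩, T⟩ := q
  obtain rfl : μ = ν := h
  exact Sigma.ext rfl (heq_of_eq (Subtype.ext (SemistandardYoungTableau.ext hpq)))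

/-- Removing the entries `N + 1` from a tableau. -/
def branchEquiv (N : ℕ) (l : YoungDiagram) :
    SSYTN (N + 1) l ≃ Σ μ : {μ : YoungDiagram // μ.Interlaces l}, SSYTN N μ where
  toFun T := ⟨⟨subshape T.1 N, interlaces_iff_mem.2 ⟨fun i j h => mem_subshape.2
      ⟨l.up_left_mem (Nat.le_succ i) le_rfl h, by
        have h1 := T.1.col_strict i.lt_add_one h
        have h2 := T.2 _ _ h
        rw [Finset.mem_Icc] at h2
        omega⟩,
      fun i j h => (mem_subshape.1 h).1⟩⟩,
    { entry := fun i j => if (i, j) ∈ subshape T.1 N then T.1 i j else 0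
      row_weak' := fun {i j1 j2} hj h => by
        change (i, j2) ∈ subshape T.1 N at h
        rw [if_pos h, if_pos (YoungDiagram.up_left_mem _ le_rfl hj.le h)]
        exact T.1.row_weak hj (mem_subshape.1 h).1
      col_strict' := fun {i1 i2 j} hi h => by
        change (i2, j) ∈ subshape T.1 N at h
        rw [if_pos h, if_pos (YoungDiagram.up_left_mem _ hi.le le_rfl h)]
        exact T.1.col_strict hi (mem_subshape.1 h).1
      zeros' := fun h => if_neg h },
    fun i j h => by
      change (i, j) ∈ subshape T.1 N at h
      change (if (i, j) ∈ subshape T.1 N then T.1 i j else 0) ∈ _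
      rw [if_pos h]
      have h2 := T.2 _ _ (mem_subshape.1 h).1
      rw [Finset.mem_Icc] at h2 ⊢
      exact ⟨h2.1, (mem_subshape.1 h).2⟩⟩
  invFun p := ⟨
    { entry := fun i j => if (i, j) ∈ p.1.1 then p.2.1 i j else if (i, j) ∈ l then N + 1 else 0
      row_weak' := fun {i j1 j2} hj h => by
        have hl := l.up_left_mem le_rfl hj.le h
        by_cases h2 : (i, j2) ∈ p.1.1
        · rw [if_pos h2, if_pos (YoungDiagram.up_left_mem _ le_rfl hj.le h2)]
          exact p.2.1.row_weak hj h2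
        · rw [if_neg h2, if_pos h, if_pos hl]
          split_ifs with h1
          · have := p.2.2 _ _ h1
            rw [Finset.mem_Icc] at this
            omega
          · exact le_rfl
      col_strict' := fun {i1 i2 j} hi h => by
        have h1 : (i1, j) ∈ p.1.1 :=
          (interlaces_iff_mem.1 p.1.2).1 i1 j (l.up_left_mem hi le_rfl h)
        rw [if_pos h1, if_pos h]
        split_ifs with h2
        · exact p.2.1.col_strict hi h2
        · have := p.2.2 _ _ h1
          rw [Finset.mem_Icc] at this
          omega
      zeros' := fun {i j} h => by
        rw [if_neg fun h' => h ((interlaces_iff_mem.1 p.1.2).2 i j h'), if_neg h] },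
    fun i j h => by
      change (if (i, j) ∈ p.1.1 then p.2.1 i j else if (i, j) ∈ l then N + 1 else 0) ∈ _
      rw [if_pos h, Finset.mem_Icc]
      split_ifs with h1
      · have := p.2.2 _ _ h1
        rw [Finset.mem_Icc] at this
        omega
      · omega⟩
  left_inv := by
    rintro ⟨T, hT⟩
    refine Subtype.ext (SemistandardYoungTableau.ext fun i j => ?_)
    change (if (i, j) ∈ subshape T N then if (i, j) ∈ subshape T N then T i j else 0
      else if (i, j) ∈ l then N + 1 else 0) = T i j
    split_ifs with h1 h2
    · rfl
    · have h3 := (Finset.mem_Icc.1 (hT _ _ h2)).2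
      have h4 : ¬ T i j ≤ N := fun h => h1 (mem_subshape.2 ⟨h2, h⟩)
      omega
    · exact (T.zeros h2).symm
  right_inv := by
    rintro ⟨⟨μ, hμ⟩, ⟨S, hS⟩⟩
    have key : ∀ i j, ((i, j) ∈ l ∧ (if (i, j) ∈ μ then S i j else
        if (i, j) ∈ l then N + 1 else 0) ≤ N) ↔ (i, j) ∈ μ := by
      intro i j
      constructor
      · rintro ⟨h1, h2⟩
        by_contra h
        rw [if_neg h, if_pos h1] at h2
        omega
      · intro h
        rw [if_pos h]
        exact ⟨(interlaces_iff_mem.1 hμ).2 i j h, (Finset.mem_Icc.1 (hS i j h)).2⟩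
    refine sigma_SSYTN_ext (SetLike.ext fun ⟨i, j⟩ => mem_subshape.trans (key i j)) fun i j => ?_
    refine (if_congr (mem_subshape.trans (key i j)) rfl rfl).trans ?_
    change (if (i, j) ∈ μ then if (i, j) ∈ μ then S i j else
        if (i, j) ∈ l then N + 1 else 0 else 0) = S i j
    split_ifs with h
    · rfl
    · exact (S.zeros h).symm

theorem finite_interlaces (l : YoungDiagram) : Finite {μ : YoungDiagram // μ.Interlaces l} := by
  refine Finite.of_injective
    (fun μ => (⟨μ.1.cells, Finset.mem_powerset.2 (cells_subset_iff.2 μ.2.le)⟩ :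
      {s // s ∈ l.cells.powerset})) fun μ ν h => ?_
  exact Subtype.ext (YoungDiagram.ext (Subtype.ext_iff.1 h))

theorem isEmpty_SSYTN_zero {l : YoungDiagram} (hl : l ≠ ⊥) : IsEmpty (SSYTN 0 l) := by
  refine ⟨fun T => hl (le_bot_iff.1 ?_)⟩
  rw [← SetLike.coe_subset_coe]
  rintro ⟨i, j⟩ h
  simpa using T.2 i j h

instance subsingleton_SSYTN_zero : Subsingleton (SSYTN 0 ⊥) :=
  ⟨fun S T => Subtype.ext (SemistandardYoungTableau.ext fun i j => by
    rw [S.1.zeros (notMem_bot _), T.1.zeros (notMem_bot _)])⟩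

theorem dCount_zero (l : YoungDiagram) : dCount 0 l = if l = ⊥ then 1 else 0 := by
  split_ifs with h
  · subst h
    have : Nonempty (SSYTN 0 ⊥) := ⟨default, fun i j h => (notMem_bot _ h).elim⟩
    exact Nat.card_eq_one_iff_unique.2 ⟨inferInstance, this⟩
  · have := isEmpty_SSYTN_zero h
    exact Nat.card_of_isEmpty

instance finite_SSYTN (N : ℕ) : ∀ l, Finite (SSYTN N l) := by
  induction N with
  | zero =>
    intro l
    by_cases h : l = ⊥
    · subst h
      infer_instance
    · have := isEmpty_SSYTN_zero h
      infer_instance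
  | succ N ih =>
    intro l
    have := finite_interlaces l
    exact Finite.of_equiv _ (branchEquiv N l).symm

/-- The generating weight of the tableaux of shape `l`. -/
def tableauWeight (t : ℝ≥0∞) (N : ℕ) (l : YoungDiagram) : ℝ≥0∞ :=
  t ^ l.card * dCount N l

theorem tableauWeight_zero (t : ℝ≥0∞) (l : YoungDiagram) :
    tableauWeight t 0 l = if l = ⊥ then 1 else 0 := by
  rw [tableauWeight, dCount_zero]
  split_ifs with h
  · simp [h, card_bot]
  · simp

theorem dCount_succ (N : ℕ) (l : YoungDiagram) :
    (dCount (N + 1) l : ℝ≥0∞) = ∑' μ : {μ : YoungDiagram // μ.Interlaces l}, (dCount N μ : ℝ≥0∞) := by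
  have := finite_interlaces l
  have := Fintype.ofFinite {μ : YoungDiagram // μ.Interlaces l}
  rw [tsum_fintype, dCount, Nat.card_congr (branchEquiv N l), Nat.card_sigma]
  push_cast
  rfl

theorem tableauWeight_succ (t : ℝ≥0∞) (N : ℕ) (l : YoungDiagram) :
    tableauWeight t (N + 1) l = ∑' μ, stripWeight t l μ * tableauWeight t N μ := by
  have h : ∀ μ, stripWeight t l μ * tableauWeight t N μ =
      {μ : YoungDiagram | μ.Interlaces l}.indicator
        (fun μ => t ^ l.card * (dCount N μ : ℝ≥0∞)) μ := by
    intro μ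
    simp only [stripWeight, tableauWeight, Set.indicator, Set.mem_ofPred_eq]
    split_ifs with h
    · rw [← mul_assoc, ← pow_add, Nat.sub_add_cancel h.card_le]
    · simp
  simp only [h]
  rw [← tsum_subtype, ENNReal.tsum_mul_left, tableauWeight, dCount_succ]
  rfl

theorem tsum_stripWeight_mul_tableauWeight (t : ℝ≥0∞) (N : ℕ) (b : YoungDiagram) :
    ∑' μ, stripWeight t μ b * tableauWeight t N μ =
      (∑' k : ℕ, (t ^ 2) ^ k) ^ N * tableauWeight t N b := by
  induction N generalizing b with
  | zero =>
    rw [tsum_eq_single ⊥ fun μ hμ => by simp [tableauWeight_zero, hμ]]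
    simp only [tableauWeight_zero, stripWeight, interlaces_bot]
    split_ifs with h
    · simp [h]
    · simp
  | succ N ih =>
    simp only [tableauWeight_succ, ← ENNReal.tsum_mul_left]
    rw [ENNReal.tsum_comm]
    have h : ∀ a, ∑' μ, stripWeight t μ b * (stripWeight t μ a * tableauWeight t N a) =
        (∑' k : ℕ, (t ^ 2) ^ k) * ∑' c, stripWeight t b c *
          (stripWeight t a c * tableauWeight t N a) := by
      intro a
      simp only [← mul_assoc]
      rw [ENNReal.tsum_mul_right, tsum_stripWeight_mul_stripWeight, mul_assoc,
        ENNReal.tsum_mul_right]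
    simp only [h]
    rw [ENNReal.tsum_mul_left, ENNReal.tsum_comm]
    simp only [ENNReal.tsum_mul_left, ih]
    generalize (∑' k : ℕ, (t ^ 2) ^ k) = e
    rw [pow_succ', mul_assoc, ← ENNReal.tsum_mul_left (a := e ^ N)]
    congr 1
    exact tsum_congr fun c => mul_left_comm _ _ _

theorem tsum_oddCols_mul_tableauWeight (t β : ℝ≥0∞) (N : ℕ) :
    ∑' l, β ^ oddCols l * tableauWeight t N l =
      (∑' k : ℕ, (t ^ 2) ^ k) ^ (N * (N - 1) / 2) * (∑' k : ℕ, (β * t) ^ k) ^ N := by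
  induction N with
  | zero =>
    rw [tsum_eq_single ⊥ fun μ hμ => by simp [tableauWeight_zero, hμ]]
    simp [tableauWeight_zero, oddCols, card_bot]
  | succ N ih =>
    simp only [tableauWeight_succ, ← ENNReal.tsum_mul_left]
    rw [ENNReal.tsum_comm]
    have h : ∀ a, ∑' l, β ^ oddCols l * (stripWeight t l a * tableauWeight t N a) =
        (∑' k : ℕ, (β * t) ^ k) * ∑' c, β ^ oddCols c *
          (stripWeight t a c * tableauWeight t N a) := by
      intro a
      simp only [← mul_assoc]
      rw [ENNReal.tsum_mul_right, tsum_oddCols_mul_stripWeight, mul_assoc,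
        ENNReal.tsum_mul_right]
    simp only [h]
    rw [ENNReal.tsum_mul_left, ENNReal.tsum_comm]
    simp only [ENNReal.tsum_mul_left, tsum_stripWeight_mul_tableauWeight]
    simp only [mul_left_comm _ ((∑' k : ℕ, (t ^ 2) ^ k) ^ N)]
    rw [ENNReal.tsum_mul_left, ih, Nat.triangle_succ]
    generalize (∑' k : ℕ, (t ^ 2) ^ k) = e
    rw [pow_add, pow_succ]
    ring

end YoungDiagram

theorem ENNReal.tsum_ofReal_geometric {r : ℝ} (hr : 0 ≤ r) (hr1 : r < 1) :
    ∑' k : ℕ, ENNReal.ofReal r ^ k = ENNReal.ofReal (1 - r)⁻¹ := by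
  rw [ENNReal.tsum_geometric, ENNReal.ofReal_inv_of_pos (by linarith),
    ENNReal.ofReal_sub _ hr, ENNReal.ofReal_one]

/-- `Σ_λ t^{|λ|} β^{f(λ')} d_λ(N) = (1-t²)^{-N(N-1)/2} (1-βt)^{-N}`, the sum
converging over all partitions `λ`. -/
theorem tsum_dCount_eq (t β : ℝ) (ht : 0 < t) (ht1 : t < 1)
    (hβ : 0 < β) (hβt : β * t < 1) (N : ℕ) (hN : 0 < N) :
    HasSum (fun μ : YoungDiagram => t ^ μ.card * β ^ (oddCols μ) * (dCount N μ : ℝ))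
      (((1 - t ^ 2) ^ (N * (N - 1) / 2))⁻¹ * ((1 - β * t) ^ N)⁻¹) := by
  have ht2 : t ^ 2 < 1 := by nlinarith
  have h := YoungDiagram.tsum_oddCols_mul_tableauWeight (ENNReal.ofReal t) (ENNReal.ofReal β) N
  rw [← ENNReal.ofReal_mul hβ.le, ← ENNReal.ofReal_pow ht.le,
    ENNReal.tsum_ofReal_geometric (by positivity) ht2,
    ENNReal.tsum_ofReal_geometric (by positivity) hβt,
    ← ENNReal.ofReal_pow (inv_nonneg.2 (by linarith)),
    ← ENNReal.ofReal_pow (inv_nonneg.2 (by linarith)),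
    ← ENNReal.ofReal_mul (pow_nonneg (inv_nonneg.2 (by linarith)) _), inv_pow, inv_pow] at h
  have hterm : ∀ μ : YoungDiagram,
      ENNReal.ofReal β ^ oddCols μ * YoungDiagram.tableauWeight (ENNReal.ofReal t) N μ =
      ENNReal.ofReal (t ^ μ.card * β ^ oddCols μ * (dCount N μ : ℝ)) := by
    intro μ
    rw [ENNReal.ofReal_mul (by positivity), ENNReal.ofReal_mul (by positivity),
      ENNReal.ofReal_pow ht.le, ENNReal.ofReal_pow hβ.le, ENNReal.ofReal_natCast,
      YoungDiagram.tableauWeight]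
    ring
  simp only [hterm] at h
  have hpos : 0 ≤ ((1 - t ^ 2) ^ (N * (N - 1) / 2))⁻¹ * ((1 - β * t) ^ N)⁻¹ :=
    mul_nonneg (inv_nonneg.2 (pow_nonneg (by linarith) _))
      (inv_nonneg.2 (pow_nonneg (by linarith) _))
  have hr := ENNReal.hasSum_toReal (h ▸ ENNReal.ofReal_ne_top)
  rw [← ENNReal.tsum_toReal_eq fun _ => ENNReal.ofReal_ne_top, h, ENNReal.toReal_ofReal hpos] at hr
  convert hr using 2 with μ
  exact (ENNReal.toReal_ofReal (by positivity)).symm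
end
end
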